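/- arXiv:1301.2449 — 5 statements merged into one kernel-verified Lean document; each statement's English description precedes it below -/
import Mathlib

section
/- Let C be an open convex cone in a finite-dimensional real vector space V, let f be completely monotone on C × (0,∞), and let β ≥ 1/2. Then the function g(x,y,z) = (y+z)^{-β} f(x, yz/(y+z)) is completely monotone on C × (0,∞)^2. -/
/-- Complete monotonicity on an (open convex cone) subset `C` of a real normed space:
`f` is `C^∞` on `C` and `(−1)^k D_{u_1}···D_{u_k} f(x) ≥ 0` for all `k ≥ 0`, all
directions `u_1, …, u_k ∈ C` and all `x ∈ C`. -/
def CompletelyMonotoneOn {E : Type*} [NormedAddCommGroup E] [NormedSpace ℝ E]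
    (f : E → ℝ) (C : Set E) : Prop :=
  ContDiffOn ℝ (⊤ : ℕ∞) f C ∧
    ∀ (k : ℕ) (u : Fin k → E), (∀ i, u i ∈ C) → ∀ x ∈ C,
      0 ≤ (-1 : ℝ) ^ k * iteratedFDerivWithin ℝ k f C x u

open Filter Topology

/-- `f` is smooth on `C` and its iterated derivatives on `C` along directions in `U` alternate in
sign. -/
def CompletelyMonotoneAlong {E : Type*} [NormedAddCommGroup E] [NormedSpace ℝ E]
    (U : Set E) (f : E → ℝ) (C : Set E) : Prop :=
  ContDiffOn ℝ (⊤ : ℕ∞) f C ∧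
    ∀ (k : ℕ) (u : Fin k → E), (∀ i, u i ∈ U) → ∀ x ∈ C,
      0 ≤ (-1 : ℝ) ^ k * iteratedFDerivWithin ℝ k f C x u

/-- The negated directional derivative of `f` along `u`. -/
noncomputable def negDeriv {E : Type*} [NormedAddCommGroup E] [NormedSpace ℝ E]
    (u : E) (f : E → ℝ) : E → ℝ := fun x => -(fderiv ℝ f x u)

section
variable {E : Type*} [NormedAddCommGroup E] [NormedSpace ℝ E] {U C : Set E} {f g : E → ℝ}

lemma ContDiffOn.negDeriv (hC : IsOpen C) (hf : ContDiffOn ℝ (⊤ : ℕ∞) f C) (u : E) :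
    ContDiffOn ℝ (⊤ : ℕ∞) (negDeriv u f) C :=
  ((hf.fderiv_of_isOpen hC (by simp)).clm_apply contDiffOn_const).neg

lemma Set.EqOn.negDeriv (hC : IsOpen C) (h : Set.EqOn f g C) (u : E) :
    Set.EqOn (negDeriv u f) (negDeriv u g) C := fun x hx => by
  simp only [_root_.negDeriv]
  rw [(h.eventuallyEq_of_mem (hC.mem_nhds hx)).fderiv_eq]

lemma ContDiffOn.hasFDerivAt_of_isOpen (hC : IsOpen C) (hf : ContDiffOn ℝ (⊤ : ℕ∞) f C)
    {x : E} (hx : x ∈ C) : HasFDerivAt f (fderiv ℝ f x) x :=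
  ((hf.contDiffAt (hC.mem_nhds hx)).differentiableAt (by simp)).hasFDerivAt

lemma negDeriv_comm (hC : IsOpen C) (hf : ContDiffOn ℝ (⊤ : ℕ∞) f C) (u v : E) :
    Set.EqOn (negDeriv u (negDeriv v f)) (negDeriv v (negDeriv u f)) C := fun x hx => by
  have hfx := hf.contDiffAt (hC.mem_nhds hx)
  have hsymm := hfx.isSymmSndFDerivAt (by simp; exact WithTop.coe_le_coe.2 le_top)
  have hd : DifferentiableAt ℝ (fderiv ℝ f) x :=
    ((hf.fderiv_of_isOpen (m := (⊤ : ℕ∞)) hC (by simp)).contDiffAt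
      (hC.mem_nhds hx)).differentiableAt (by simp)
  have key : ∀ a b : E, negDeriv a (negDeriv b f) x = fderiv ℝ (fderiv ℝ f) x a b := by
    intro a b
    change -(fderiv ℝ (fun y => -(fderiv ℝ f y b)) x a) = _
    rw [((hd.hasFDerivAt.clm_apply (hasFDerivAt_const b x)).fun_neg).fderiv]
    simp
  rw [key, key, hsymm u v]

lemma iteratedFDerivWithin_succ_eq_negDeriv (hC : IsOpen C) (hf : ContDiffOn ℝ (⊤ : ℕ∞) f C)
    (k : ℕ) (u : Fin (k + 1) → E) {x : E} (hx : x ∈ C) :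
    iteratedFDerivWithin ℝ (k + 1) f C x u =
      -iteratedFDerivWithin ℝ k (negDeriv (u (Fin.last k)) f) C x (Fin.init u) := by
  have hd : ContDiffOn ℝ (⊤ : ℕ∞) (fderivWithin ℝ f C) C :=
    hf.fderivWithin hC.uniqueDiffOn (by simp)
  have heq : Set.EqOn (negDeriv (u (Fin.last k)) f)
      (-fun y => fderivWithin ℝ f C y (u (Fin.last k))) C := fun y hy => by
    simp [negDeriv, fderivWithin_of_isOpen hC hy]
  rw [iteratedFDerivWithin_succ_apply_right hC.uniqueDiffOn hx,
    iteratedFDerivWithin_congr heq hx, iteratedFDerivWithin_neg_apply hC.uniqueDiffOn hx,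
    ← iteratedFDerivWithin_clm_apply_const_apply hC.uniqueDiffOn hd
      (by exact_mod_cast le_top) hx]
  simp

namespace CompletelyMonotoneAlong

lemma congr (hf : CompletelyMonotoneAlong U f C) (h : Set.EqOn g f C) :
    CompletelyMonotoneAlong U g C :=
  ⟨hf.1.congr h, fun k u hu x hx => by
    rw [iteratedFDerivWithin_congr h hx]; exact hf.2 k u hu x hx⟩

lemma nonneg (hf : CompletelyMonotoneAlong U f C) {x : E} (hx : x ∈ C) : 0 ≤ f x := by
  simpa using hf.2 0 Fin.elim0 (fun i => i.elim0) x hx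

lemma negDeriv (hC : IsOpen C) (hf : CompletelyMonotoneAlong U f C) {u : E} (hu : u ∈ U) :
    CompletelyMonotoneAlong U (negDeriv u f) C := by
  refine ⟨hf.1.negDeriv hC u, fun k v hv x hx => ?_⟩
  have h := hf.2 (k + 1) (Fin.snoc (α := fun _ => E) v u)
    (fun i => Fin.lastCases (by simpa using hu) (fun j => by simpa using hv j) i) x hx
  rw [iteratedFDerivWithin_succ_eq_negDeriv hC hf.1 k _ hx] at h
  simpa [pow_succ] using h

lemma closure_directions (hf : CompletelyMonotoneAlong U f C) :
    CompletelyMonotoneAlong (closure U) f C := by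
  refine ⟨hf.1, fun k u hu x hx => ?_⟩
  have hcl : IsClosed {v : Fin k → E | 0 ≤ (-1 : ℝ) ^ k * iteratedFDerivWithin ℝ k f C x v} :=
    isClosed_le continuous_const (continuous_const.mul (ContinuousMultilinearMap.cont _))
  have hmem : u ∈ closure (Set.univ.pi fun _ : Fin k => U) := by
    rw [closure_pi_set]; exact fun i _ => hu i
  exact hcl.closure_subset_iff.2
    (fun v (hv : v ∈ Set.univ.pi _) => hf.2 k v (fun i => hv i trivial) x hx) hmem

/-- A family of smooth nonnegative functions whose negated directional derivatives are sums of two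
members of the family consists of completely monotone functions. -/
lemma of_family (hC : IsOpen C) (𝓕 : Set (E → ℝ))
    (hsmooth : ∀ F ∈ 𝓕, ContDiffOn ℝ (⊤ : ℕ∞) F C) (hnonneg : ∀ F ∈ 𝓕, ∀ x ∈ C, 0 ≤ F x)
    (hstep : ∀ F ∈ 𝓕, ∀ u ∈ U, ∃ G₁ ∈ 𝓕, ∃ G₂ ∈ 𝓕,
      Set.EqOn (_root_.negDeriv u F) (G₁ + G₂) C) :
    ∀ F ∈ 𝓕, CompletelyMonotoneAlong U F C := by
  intro F hF
  refine ⟨hsmooth F hF, fun k => ?_⟩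
  induction k generalizing F with
  | zero => intro u _ x hx; simpa using hnonneg F hF x hx
  | succ k ih =>
    intro u hu x hx
    obtain ⟨G₁, hG₁, G₂, hG₂, heq⟩ := hstep F hF (u (Fin.last k)) (hu _)
    have h1 := ih G₁ hG₁ (Fin.init u) (fun i => hu _) x hx
    have h2 := ih G₂ hG₂ (Fin.init u) (fun i => hu _) x hx
    have hle : ((k : ℕ∞) : WithTop ℕ∞) ≤ ((⊤ : ℕ∞) : WithTop ℕ∞) := by exact_mod_cast le_top
    rw [iteratedFDerivWithin_succ_eq_negDeriv hC (hsmooth F hF) k _ hx,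
      iteratedFDerivWithin_congr heq hx, iteratedFDerivWithin_add_apply
        (((hsmooth _ hG₁) x hx).of_le hle) (((hsmooth _ hG₂) x hx).of_le hle) hC.uniqueDiffOn hx]
    rw [_root_.add_apply, pow_succ]
    linarith

lemma of_family_single (hC : IsOpen C) (𝓕 : Set (E → ℝ))
    (hsmooth : ∀ F ∈ 𝓕, ContDiffOn ℝ (⊤ : ℕ∞) F C) (hnonneg : ∀ F ∈ 𝓕, ∀ x ∈ C, 0 ≤ F x)
    (hzero : 0 ∈ 𝓕) (hstep : ∀ F ∈ 𝓕, ∀ u ∈ U, _root_.negDeriv u F ∈ 𝓕) :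
    ∀ F ∈ 𝓕, CompletelyMonotoneAlong U F C :=
  of_family hC 𝓕 hsmooth hnonneg fun F hF u hu =>
    ⟨_, hstep F hF u hu, 0, hzero, fun x _ => by simp⟩

lemma mul (hC : IsOpen C) (hf : CompletelyMonotoneAlong U f C)
    (hg : CompletelyMonotoneAlong U g C) : CompletelyMonotoneAlong U (f * g) C := by
  refine of_family hC {F | ∃ a b, CompletelyMonotoneAlong U a C ∧ CompletelyMonotoneAlong U b C ∧
    F = a * b} ?_ ?_ ?_ _ ⟨f, g, hf, hg, rfl⟩
  · rintro _ ⟨a, b, ha, hb, rfl⟩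
    exact ha.1.mul hb.1
  · rintro _ ⟨a, b, ha, hb, rfl⟩ x hx
    exact mul_nonneg (ha.nonneg hx) (hb.nonneg hx)
  · rintro _ ⟨a, b, ha, hb, rfl⟩ u hu
    refine ⟨_, ⟨_, _, ha.negDeriv hC hu, hb, rfl⟩, _, ⟨_, _, ha, hb.negDeriv hC hu, rfl⟩, ?_⟩
    intro x hx
    have h := (ha.1.hasFDerivAt_of_isOpen hC hx).mul (hb.1.hasFDerivAt_of_isOpen hC hx)
    rw [_root_.negDeriv, h.fderiv]
    simp [_root_.negDeriv]
    ring

end CompletelyMonotoneAlong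
end

/-- The Taylor sum at `s` of order `M` of the alternating derivative sequence `h`, evaluated
at `x`. -/
noncomputable def alternatingTaylor (h : ℕ → ℝ → ℝ) (x : ℝ) (M : ℕ) (s : ℝ) : ℝ :=
  ∑ i ∈ Finset.range (M + 1), (s - x) ^ i / (i.factorial : ℝ) * h i s

lemma alternatingTaylor_self (h : ℕ → ℝ → ℝ) (x : ℝ) (M : ℕ) :
    alternatingTaylor h x M x = h 0 x := by
  simp [alternatingTaylor, Finset.sum_range_succ']

lemma hasDerivAt_alternatingTaylor {h : ℕ → ℝ → ℝ} {s : ℝ}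
    (hder : ∀ j, HasDerivAt (h j) (-h (j + 1) s) s) (x : ℝ) (M : ℕ) :
    HasDerivAt (alternatingTaylor h x M)
      (-((s - x) ^ M / (M.factorial : ℝ) * h (M + 1) s)) s := by
  induction M with
  | zero =>
    have : alternatingTaylor h x 0 = h 0 := by ext; simp [alternatingTaylor]
    simpa [this] using hder 0
  | succ M ih =>
    have hsucc : alternatingTaylor h x (M + 1) = fun s => alternatingTaylor h x M s +
        (s - x) ^ (M + 1) / ((M + 1).factorial : ℝ) * h (M + 1) s := by
      ext s; simp only [alternatingTaylor]; rw [Finset.sum_range_succ]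
    rw [hsucc]
    have hpow := ((((hasDerivAt_id s).sub_const x).pow (M + 1)).div_const
      ((M + 1).factorial : ℝ)).mul (hder (M + 1))
    refine (ih.add hpow).congr_deriv ?_
    have : ((M.factorial : ℝ)) ≠ 0 := by positivity
    simp only [Nat.factorial_succ, id, Pi.pow_apply]
    push_cast
    have h2 : (M : ℝ) + 1 ≠ 0 := by positivity
    simp
    field_simp
    ring

/-- `s ^ (k + 1) * h (k + 1) s` vanishes at infinity when `h` is the sequence of alternating
derivatives of a completely monotone function on the half line. -/
lemma tendsto_pow_mul_alternating {h : ℕ → ℝ → ℝ} (hpos : ∀ j t, 0 < t → 0 ≤ h j t)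
    (hder : ∀ j t, 0 < t → HasDerivAt (h j) (-h (j + 1) t) t) (k : ℕ) :
    Tendsto (fun s => s ^ (k + 1) * h (k + 1) s) atTop (𝓝 0) := by
  have hanti : ∀ j a b, 0 < a → a ≤ b → h j b ≤ h j a := by
    intro j a b ha hab
    have hd : ∀ t ∈ Set.Ioi (0 : ℝ), HasDerivAt (h j) (-h (j + 1) t) t := fun t ht => hder j t ht
    refine antitoneOn_of_deriv_nonpos (convex_Ioi (0 : ℝ))
      (fun t ht => (hd t ht).continuousAt.continuousWithinAt)
      (fun t ht => ?_) (fun t ht => ?_) (Set.mem_Ioi.2 ha) (Set.mem_Ioi.2 (ha.trans_le hab)) hab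
    · rw [interior_Ioi] at ht
      exact (hd t ht).differentiableAt.differentiableWithinAt
    · rw [interior_Ioi] at ht
      rw [(hd t ht).deriv]
      exact neg_nonpos.2 (hpos _ t ht)
  have hbound : ∀ j s, 0 < s → h (j + 1) s * (s / 2) ≤ h j (s / 2) - h j s := by
    intro j s hs
    obtain ⟨c, hc, hc'⟩ := exists_hasDerivAt_eq_slope (h j) (fun t => -h (j + 1) t)
      (show s / 2 < s by linarith)
      (fun t ht => (hder j t (by linarith [ht.1])).continuousAt.continuousWithinAt)
      (fun t ht => hder j t (by linarith [ht.1]))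
    have h1 := hanti (j + 1) c s (by linarith [hc.1]) hc.2.le
    rw [eq_div_iff (by linarith)] at hc'
    nlinarith
  have hhalf : Tendsto (fun s : ℝ => s / 2) atTop atTop :=
    tendsto_id.atTop_div_const (by norm_num)
  induction k with
  | zero =>
    have hlim : ∃ L, Tendsto (h 0) atTop (𝓝 L) := by
      refine ⟨_, (tendsto_atTop_ciInf (f := fun s => h 0 (max s 1)) ?_ ?_).congr' ?_⟩
      · intro a b hab
        exact hanti 0 _ _ (by positivity) (max_le_max_right 1 hab)
      · exact ⟨0, by rintro _ ⟨s, rfl⟩; exact hpos 0 _ (by positivity)⟩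
      · filter_upwards [eventually_ge_atTop 1] with s hs
        simp [max_eq_left hs]
    obtain ⟨L, hL⟩ := hlim
    have hdiff : Tendsto (fun s => 2 * (h 0 (s / 2) - h 0 s)) atTop (𝓝 0) := by
      simpa using ((hL.comp hhalf).sub hL).const_mul 2
    refine tendsto_of_tendsto_of_tendsto_of_le_of_le' tendsto_const_nhds hdiff ?_ ?_
    · filter_upwards [eventually_gt_atTop 0] with s hs
      have := hpos 1 s hs
      positivity
    · filter_upwards [eventually_gt_atTop 0] with s hs
      have := hbound 0 s hs
      simp only [zero_add, pow_one] at this ⊢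
      linarith
  | succ k ih =>
    have hdiff : Tendsto (fun s => 2 ^ (k + 2) * ((s / 2) ^ (k + 1) * h (k + 1) (s / 2)))
        atTop (𝓝 0) := by
      simpa using (ih.comp hhalf).const_mul (2 ^ (k + 2))
    refine tendsto_of_tendsto_of_tendsto_of_le_of_le' tendsto_const_nhds hdiff ?_ ?_
    · filter_upwards [eventually_gt_atTop 0] with s hs
      have := hpos (k + 1 + 1) s hs
      positivity
    · filter_upwards [eventually_gt_atTop 0] with s hs
      have h1 := hbound (k + 1) s hs
      have h2 := hpos (k + 1) s hs
      have h3 : h (k + 1 + 1) s * (s / 2) ≤ h (k + 1) (s / 2) := by linarith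
      have h4 := mul_le_mul_of_nonneg_left h3 (show 0 ≤ 2 * s ^ (k + 1) by positivity)
      have h5 : 2 ^ (k + 2) * ((s / 2) ^ (k + 1) * h (k + 1) (s / 2)) =
          2 * s ^ (k + 1) * h (k + 1) (s / 2) := by
        rw [div_pow]; field_simp; ring
      rw [h5]
      calc _ = 2 * s ^ (k + 1) * (h (k + 1 + 1) s * (s / 2)) := by ring
        _ ≤ _ := h4

lemma tendsto_alternatingTaylor {h : ℕ → ℝ → ℝ} (hpos : ∀ j t, 0 < t → 0 ≤ h j t)
    (hder : ∀ j t, 0 < t → HasDerivAt (h j) (-h (j + 1) t) t) {x : ℝ} (hx : 0 < x) (j M : ℕ) :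
    Tendsto (alternatingTaylor (fun i => h (j + 1 + i)) x M) atTop (𝓝 0) := by
  have : ∀ i ∈ Finset.range (M + 1), Tendsto
      (fun s => (s - x) ^ i / (i.factorial : ℝ) * h (j + 1 + i) s) atTop (𝓝 0) := by
    intro i _
    refine tendsto_of_tendsto_of_tendsto_of_le_of_le' tendsto_const_nhds
      (tendsto_pow_mul_alternating hpos hder (j + i)) ?_ ?_
    · filter_upwards [eventually_ge_atTop x] with s hs
      have h1 := hpos (j + 1 + i) s (by linarith)
      have h2 : 0 ≤ s - x := by linarith
      positivity
    · filter_upwards [eventually_ge_atTop x, eventually_ge_atTop 1] with s hs hs1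
      have h1 := hpos (j + 1 + i) s (by linarith)
      have h2 : 0 ≤ s - x := by linarith
      rw [show j + i + 1 = j + 1 + i by ring]
      refine mul_le_mul_of_nonneg_right ?_ h1
      calc (s - x) ^ i / (i.factorial : ℝ) ≤ (s - x) ^ i :=
            div_le_self (by positivity)
              (by exact_mod_cast Nat.one_le_iff_ne_zero.2 i.factorial_ne_zero)
        _ ≤ s ^ i := by gcongr; linarith
        _ ≤ s ^ (j + 1 + i) := pow_le_pow_right₀ hs1 (by omega)
  have hsum := tendsto_finsetSum _ this
  rw [Finset.sum_const_zero] at hsum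
  exact hsum

lemma sum_mul_alternating_nonneg_of_truncated {h : ℕ → ℝ → ℝ}
    (hpos : ∀ j t, 0 < t → 0 ≤ h j t)
    (hder : ∀ j t, 0 < t → HasDerivAt (h j) (-h (j + 1) t) t) {x : ℝ} (hx : 0 < x)
    {p : ℕ → ℝ} {d N : ℕ} (hdN : d ≤ N) (hp0 : 0 ≤ p 0)
    (hp : ∀ r, 0 < r →
      0 ≤ ∑ j ∈ Finset.range (d + 1), p j * (r ^ (N - j) / ((N - j).factorial : ℝ))) :
    0 ≤ ∑ j ∈ Finset.range (d + 1), p j * h j x := by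
  set G : ℝ → ℝ := fun s => ∑ j ∈ Finset.range (d + 1),
    p j * alternatingTaylor (fun i => h (j + i)) x (N - j) s with hG
  have hGx : G x = ∑ j ∈ Finset.range (d + 1), p j * h j x := by
    simp [hG, alternatingTaylor_self]
  have hGd : ∀ s, 0 < s → HasDerivAt G (-((∑ j ∈ Finset.range (d + 1),
      p j * ((s - x) ^ (N - j) / ((N - j).factorial : ℝ))) * h (N + 1) s)) s := by
    intro s hs
    have := HasDerivAt.fun_sum (u := Finset.range (d + 1)) (fun j _ =>
      (hasDerivAt_alternatingTaylor (h := fun i => h (j + i)) (s := s)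
        (fun i => hder (j + i) s hs) x (N - j)).const_mul (p j))
    refine this.congr_deriv ?_
    rw [Finset.sum_mul, ← Finset.sum_neg_distrib]
    refine Finset.sum_congr rfl fun j hj => ?_
    have : j + (N - j + 1) = N + 1 := by have := Finset.mem_range.1 hj; omega
    rw [this]; ring
  have hanti : AntitoneOn G (Set.Ici x) := by
    refine antitoneOn_of_deriv_nonpos (convex_Ici x)
      (fun t ht => (hGd t (hx.trans_le ht)).continuousAt.continuousWithinAt)
      (fun t ht => ?_) (fun t ht => ?_) <;> rw [interior_Ici] at ht
    · exact (hGd t (hx.trans ht)).differentiableAt.differentiableWithinAt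
    · rw [(hGd t (hx.trans ht)).deriv]
      exact neg_nonpos.2 (mul_nonneg (hp _ (sub_pos.2 ht)) (hpos _ _ (hx.trans ht)))
  have hlim : Tendsto (fun s => G s - p 0 * alternatingTaylor h x N s) atTop (𝓝 0) := by
    have h1 : (fun s => G s - p 0 * alternatingTaylor h x N s) = fun s =>
        ∑ j ∈ Finset.range d,
          p (j + 1) * alternatingTaylor (fun i => h (j + 1 + i)) x (N - (j + 1)) s := by
      ext s; simp [hG, Finset.sum_range_succ']
    rw [h1]
    simpa using tendsto_finsetSum (Finset.range d) (fun j _ =>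
      (tendsto_alternatingTaylor hpos hder hx j (N - (j + 1))).const_mul (p (j + 1)))
  rw [← hGx]
  refine le_of_tendsto hlim ?_
  filter_upwards [eventually_ge_atTop x] with s hs
  have h1 : 0 ≤ alternatingTaylor h x N s := by
    refine Finset.sum_nonneg fun i _ => mul_nonneg ?_ (hpos i s (hx.trans_le hs))
    have : 0 ≤ s - x := sub_nonneg.2 hs
    positivity
  have h2 : G s ≤ G x := hanti Set.self_mem_Ici hs hs
  have h3 := mul_nonneg hp0 h1
  linarith

/-- If `∑ p j * τ ^ j` is nonnegative for all `τ ≥ 0`, then replacing the power `τ ^ j` by the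
`j`-th alternating derivative of a completely monotone function on the half line keeps it
nonnegative. -/
lemma sum_mul_alternating_nonneg {h : ℕ → ℝ → ℝ} (hpos : ∀ j t, 0 < t → 0 ≤ h j t)
    (hder : ∀ j t, 0 < t → HasDerivAt (h j) (-h (j + 1) t) t) {x : ℝ} (hx : 0 < x)
    {p : ℕ → ℝ} {d : ℕ} (hp : ∀ τ, 0 ≤ τ → 0 ≤ ∑ j ∈ Finset.range d, p j * τ ^ j) :
    0 ≤ ∑ j ∈ Finset.range d, p j * h j x := by
  cases d with
  | zero => simp
  | succ d =>
  have hp0 : 0 ≤ p 0 := by simpa [Finset.sum_range_succ'] using hp 0 le_rfl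
  have key : ∀ ε, 0 < ε → 0 ≤ ∑ j ∈ Finset.range (d + 1), (p j + ε) * h j x := by
    intro ε hε
    have hc : ∀ j : ℕ,
        Tendsto (fun N : ℕ => (N.descFactorial j : ℝ) / (N : ℝ) ^ j) atTop (𝓝 1) := by
      intro j
      induction j with
      | zero => simp
      | succ j ih =>
        have h1 : Tendsto (fun N : ℕ => 1 - (j : ℝ) / (N : ℝ)) atTop (𝓝 1) := by
          simpa using tendsto_const_nhds.sub (tendsto_const_div_atTop_nhds_zero_nat (j : ℝ))
        have h2 := h1.mul ih
        rw [one_mul] at h2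
        refine h2.congr' ?_
        filter_upwards [eventually_ge_atTop (j + 1)] with N hN
        have hN0 : (N : ℝ) ≠ 0 := by exact_mod_cast (by omega : N ≠ 0)
        rw [Nat.descFactorial_succ, Nat.cast_mul, Nat.cast_sub (by omega)]
        field_simp
        ring
    have hev : ∀ᶠ N : ℕ in atTop, ∀ j ∈ Finset.range (d + 1),
        p j ≤ (p j + ε) * ((N.descFactorial j : ℝ) / (N : ℝ) ^ j) := by
      rw [Filter.eventually_all_finset]
      intro j _
      have h1 := (hc j).const_mul (p j + ε)
      rw [mul_one] at h1
      exact h1.eventually (eventually_ge_nhds (by linarith))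
    obtain ⟨N, hN, hdN⟩ := (hev.and (eventually_ge_atTop (d + 1))).exists
    refine sum_mul_alternating_nonneg_of_truncated hpos hder hx (N := N) (by omega)
      (by positivity) fun r hr => ?_
    have hN0 : (0 : ℝ) < N := by exact_mod_cast (by omega : 0 < N)
    have h1 : ∑ j ∈ Finset.range (d + 1), (p j + ε) * (r ^ (N - j) / ((N - j).factorial : ℝ)) =
        r ^ N / (N.factorial : ℝ) * ∑ j ∈ Finset.range (d + 1),
          (p j + ε) * ((N.descFactorial j : ℝ) / (N : ℝ) ^ j) * (N / r) ^ j := by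
      rw [Finset.mul_sum]
      refine Finset.sum_congr rfl fun j hj => ?_
      have hjN : j ≤ N := by have := Finset.mem_range.1 hj; omega
      have hf : (N.factorial : ℝ) = ((N - j).factorial : ℝ) * (N.descFactorial j : ℝ) := by
        exact_mod_cast (Nat.factorial_mul_descFactorial hjN).symm
      have hr' : r ^ N = r ^ (N - j) * r ^ j := by rw [← pow_add]; congr 1; omega
      have hd : (N.descFactorial j : ℝ) ≠ 0 := by
        exact_mod_cast (Nat.descFactorial_pos.2 hjN).ne'
      rw [hf, hr', div_pow]
      have : ((N - j).factorial : ℝ) ≠ 0 := by positivity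
      field_simp
    rw [h1]
    refine mul_nonneg (by positivity) ((hp (N / r) (by positivity)).trans ?_)
    exact Finset.sum_le_sum fun j hj => mul_le_mul_of_nonneg_right (hN j hj) (by positivity)
  have hlim : Tendsto (fun ε : ℝ => ∑ j ∈ Finset.range (d + 1), (p j + ε) * h j x) (𝓝[>] 0)
      (𝓝 (∑ j ∈ Finset.range (d + 1), (p j + 0) * h j x)) := by
    refine tendsto_nhdsWithin_of_tendsto_nhds (Continuous.tendsto ?_ 0)
    fun_prop
  simp only [add_zero] at hlim
  exact ge_of_tendsto hlim (by filter_upwards [self_mem_nhdsWithin] with ε hε using key ε hε)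

section
open MeasureTheory

lemma integrable_polynomial_mul_exp_neg_mul_sq (p : Polynomial ℝ) {b : ℝ} (hb : 0 < b) :
    Integrable fun s : ℝ => p.eval s * Real.exp (-b * s ^ 2) := by
  induction p using Polynomial.induction_on' with
  | add p q hp hq =>
    simp only [Polynomial.eval_add, add_mul]
    exact hp.add hq
  | monomial n c =>
    have h := (integrable_rpow_mul_exp_neg_mul_sq hb (s := n)
      (by have : (0 : ℝ) ≤ n := n.cast_nonneg
          linarith)).const_mul c
    simpa [Polynomial.eval_monomial, mul_assoc] using h

/-- The integral of a polynomial against `exp (-(y s² + z (s - a)²))`, as a function of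
`(y, z)`. -/
noncomputable def gaussianMoment (a : ℝ) (p : Polynomial ℝ) (v : ℝ × ℝ) : ℝ :=
  ∫ s : ℝ, p.eval s * Real.exp (-(v.1 * s ^ 2 + v.2 * (s - a) ^ 2))

lemma negDeriv_gaussianMoment (a : ℝ) (p : Polynomial ℝ) {v : ℝ × ℝ}
    (hv : v ∈ Set.Ioi (0 : ℝ) ×ˢ Set.Ioi (0 : ℝ)) (u : ℝ × ℝ) :
    negDeriv u (gaussianMoment a p) v = gaussianMoment a
      (p * (Polynomial.C u.1 * Polynomial.X ^ 2 +
        Polynomial.C u.2 * (Polynomial.X - Polynomial.C a) ^ 2)) v := by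
  have hv1 : 0 < v.1 := hv.1
  set F' : ℝ × ℝ → ℝ → (ℝ × ℝ →L[ℝ] ℝ) := fun w s =>
    (p.eval s * Real.exp (-(w.1 * s ^ 2 + w.2 * (s - a) ^ 2))) •
      (-(s ^ 2 • ContinuousLinearMap.fst ℝ ℝ ℝ + (s - a) ^ 2 • ContinuousLinearMap.snd ℝ ℝ ℝ))
    with hF'
  set bound : ℝ → ℝ := fun s => ‖(p * (Polynomial.X ^ 2 +
    (Polynomial.X - Polynomial.C a) ^ 2)).eval s * Real.exp (-(v.1 / 2) * s ^ 2)‖ with hbound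
  set S : Set (ℝ × ℝ) := Set.Ioi (v.1 / 2) ×ˢ Set.Ioi 0 with hS
  have hSo : IsOpen S := isOpen_Ioi.prod isOpen_Ioi
  have hvS : v ∈ S := ⟨half_lt_self hv1, hv.2⟩
  have hexp : ∀ w ∈ S, ∀ s : ℝ, Real.exp (-(w.1 * s ^ 2 + w.2 * (s - a) ^ 2)) ≤
      Real.exp (-(v.1 / 2) * s ^ 2) := by
    intro w hw s
    refine Real.exp_le_exp.2 ?_
    have h1 : v.1 / 2 * s ^ 2 ≤ w.1 * s ^ 2 :=
      mul_le_mul_of_nonneg_right (le_of_lt hw.1) (sq_nonneg s)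
    have h2 : 0 ≤ w.2 * (s - a) ^ 2 := mul_nonneg (le_of_lt hw.2) (sq_nonneg _)
    linarith
  have hle : ∀ s, ∀ w ∈ S, ‖F' w s‖ ≤ bound s := by
    intro s w hw
    have hL : ‖-(s ^ 2 • ContinuousLinearMap.fst ℝ ℝ ℝ +
        (s - a) ^ 2 • ContinuousLinearMap.snd ℝ ℝ ℝ)‖ ≤ s ^ 2 + (s - a) ^ 2 := by
      rw [norm_neg]
      refine (norm_add_le _ _).trans (add_le_add ?_ ?_)
      · rw [norm_smul, Real.norm_of_nonneg (sq_nonneg s)]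
        exact mul_le_of_le_one_right (sq_nonneg s) (ContinuousLinearMap.norm_fst_le ℝ ℝ ℝ)
      · rw [norm_smul, Real.norm_of_nonneg (sq_nonneg (s - a))]
        exact mul_le_of_le_one_right (sq_nonneg _) (ContinuousLinearMap.norm_snd_le ℝ ℝ ℝ)
    have hq : (0 : ℝ) ≤ s ^ 2 + (s - a) ^ 2 := by positivity
    calc ‖F' w s‖ = |p.eval s| * Real.exp (-(w.1 * s ^ 2 + w.2 * (s - a) ^ 2)) *
          ‖-(s ^ 2 • ContinuousLinearMap.fst ℝ ℝ ℝ +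
            (s - a) ^ 2 • ContinuousLinearMap.snd ℝ ℝ ℝ)‖ := by
          rw [hF', norm_smul, norm_mul, Real.norm_eq_abs, Real.norm_of_nonneg (Real.exp_nonneg _)]
      _ ≤ |p.eval s| * Real.exp (-(v.1 / 2) * s ^ 2) * (s ^ 2 + (s - a) ^ 2) := by
          exact mul_le_mul (mul_le_mul_of_nonneg_left (hexp w hw s) (abs_nonneg _)) hL
            (norm_nonneg _) (by positivity)
      _ = bound s := by
          simp only [hbound, Polynomial.eval_mul, Polynomial.eval_add, Polynomial.eval_pow,
            Polynomial.eval_sub, Polynomial.eval_X, Polynomial.eval_C, norm_mul,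
            Real.norm_eq_abs, abs_of_nonneg hq, Real.abs_exp]
          ring
  have hbi : Integrable bound :=
    (integrable_polynomial_mul_exp_neg_mul_sq _ (half_pos hv1)).norm
  have hmeas : ∀ w : ℝ × ℝ, AEStronglyMeasurable
      (fun s : ℝ => p.eval s * Real.exp (-(w.1 * s ^ 2 + w.2 * (s - a) ^ 2))) volume := by
    intro w
    exact Continuous.aestronglyMeasurable (by fun_prop)
  have hmeas' : AEStronglyMeasurable (F' v) volume :=
    Continuous.aestronglyMeasurable (by simp only [hF']; fun_prop)
  have hint : Integrable
      (fun s : ℝ => p.eval s * Real.exp (-(v.1 * s ^ 2 + v.2 * (s - a) ^ 2))) := by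
    refine (integrable_polynomial_mul_exp_neg_mul_sq p (half_pos hv1)).norm.mono' (hmeas v) ?_
    refine Filter.Eventually.of_forall fun s => ?_
    rw [norm_mul, norm_mul, Real.norm_of_nonneg (Real.exp_nonneg _),
      Real.norm_of_nonneg (Real.exp_nonneg _)]
    exact mul_le_mul_of_nonneg_left (hexp v hvS s) (norm_nonneg _)
  have hder := hasFDerivAt_integral_of_dominated_of_fderiv_le (𝕜 := ℝ) (μ := volume)
    (F := fun (w : ℝ × ℝ) (s : ℝ) =>
      p.eval s * Real.exp (-(w.1 * s ^ 2 + w.2 * (s - a) ^ 2))) (F' := F')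
    (hSo.mem_nhds hvS) (Filter.Eventually.of_forall hmeas) hint hmeas'
    (Filter.Eventually.of_forall hle) hbi
    (Filter.Eventually.of_forall fun s w _ => by
      have h1 : HasFDerivAt (fun w : ℝ × ℝ => -(w.1 * s ^ 2 + w.2 * (s - a) ^ 2))
          (-(s ^ 2 • ContinuousLinearMap.fst ℝ ℝ ℝ +
            (s - a) ^ 2 • ContinuousLinearMap.snd ℝ ℝ ℝ)) w :=
        ((hasFDerivAt_fst.mul_const (s ^ 2)).add (hasFDerivAt_snd.mul_const ((s - a) ^ 2))).neg
      refine (h1.exp.const_mul (p.eval s)).congr_fderiv ?_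
      rw [hF', smul_smul])
  have hF'i : Integrable (F' v) :=
    hbi.mono' hmeas' (Filter.Eventually.of_forall fun s => hle s v hvS)
  change -(fderiv ℝ (fun w : ℝ × ℝ => ∫ s : ℝ,
    p.eval s * Real.exp (-(w.1 * s ^ 2 + w.2 * (s - a) ^ 2))) v u) = _
  rw [hder.fderiv, ContinuousLinearMap.integral_apply hF'i, ← integral_neg, gaussianMoment]
  refine integral_congr_ae (Filter.Eventually.of_forall fun s => ?_)
  simp [hF']
  ring

lemma gaussianMoment_C (a c : ℝ) {v : ℝ × ℝ} (hv : v ∈ Set.Ioi (0 : ℝ) ×ˢ Set.Ioi (0 : ℝ)) :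
    gaussianMoment a (Polynomial.C c) v =
      c * (√(Real.pi / (v.1 + v.2)) * Real.exp (-(a ^ 2 * (v.1 * v.2 / (v.1 + v.2))))) := by
  have hs : 0 < v.1 + v.2 := add_pos hv.1 hv.2
  have hsq : ∀ s : ℝ, (Polynomial.C c).eval s * Real.exp (-(v.1 * s ^ 2 + v.2 * (s - a) ^ 2)) =
      c * Real.exp (-(a ^ 2 * (v.1 * v.2 / (v.1 + v.2)))) *
        Real.exp (-(v.1 + v.2) * (s - a * v.2 / (v.1 + v.2)) ^ 2) := by
    intro s
    rw [Polynomial.eval_C, mul_assoc, ← Real.exp_add]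
    congr 2
    field_simp
    ring
  simp only [gaussianMoment, hsq]
  rw [integral_const_mul,
    integral_sub_right_eq_self (fun s : ℝ => Real.exp (-(v.1 + v.2) * s ^ 2)), integral_gaussian]
  ring

/-- The quadrant `(0,∞)²`. -/
abbrev quadrant : Set (ℝ × ℝ) := Set.Ioi (0 : ℝ) ×ˢ Set.Ioi (0 : ℝ)

lemma isOpen_quadrant : IsOpen quadrant := isOpen_Ioi.prod isOpen_Ioi

lemma contDiffOn_parallel :
    ContDiffOn ℝ (⊤ : ℕ∞) (fun v : ℝ × ℝ => v.1 * v.2 / (v.1 + v.2)) quadrant :=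
  ContDiffOn.div (by fun_prop) (by fun_prop) fun v hv => (add_pos hv.1 hv.2).ne'

lemma contDiffOn_add_rpow (r : ℝ) :
    ContDiffOn ℝ (⊤ : ℕ∞) (fun v : ℝ × ℝ => (v.1 + v.2) ^ r) quadrant :=
  ContDiffOn.rpow_const_of_ne (by fun_prop) fun v hv => (add_pos hv.1 hv.2).ne'

lemma completelyMonotoneAlong_gaussian (a : ℝ) :
    CompletelyMonotoneAlong quadrant (fun v : ℝ × ℝ =>
      √(Real.pi / (v.1 + v.2)) * Real.exp (-(a ^ 2 * (v.1 * v.2 / (v.1 + v.2))))) quadrant := by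
  refine CompletelyMonotoneAlong.of_family_single isOpen_quadrant
    {F | ContDiffOn ℝ (⊤ : ℕ∞) F quadrant ∧ ∃ p : Polynomial ℝ, (∀ s, 0 ≤ p.eval s) ∧
      Set.EqOn F (gaussianMoment a p) quadrant} (fun F hF => hF.1) ?_ ?_ ?_ _ ?_
  · rintro F ⟨-, p, hp, hFp⟩ v hv
    rw [hFp hv]
    exact integral_nonneg fun s => mul_nonneg (hp s) (Real.exp_nonneg _)
  · exact ⟨contDiffOn_const, 0, by simp, fun v _ => by simp [gaussianMoment]⟩
  · rintro F ⟨hF, p, hp, hFp⟩ u hu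
    refine ⟨hF.negDeriv isOpen_quadrant u, _, fun s => ?_, fun v hv =>
      (hFp.negDeriv isOpen_quadrant u hv).trans (negDeriv_gaussianMoment a p hv u)⟩
    have h1 : 0 ≤ u.1 := le_of_lt hu.1
    have h2 : 0 ≤ u.2 := le_of_lt hu.2
    have h3 := hp s
    simp only [Polynomial.eval_mul, Polynomial.eval_add, Polynomial.eval_pow,
      Polynomial.eval_sub, Polynomial.eval_X, Polynomial.eval_C]
    positivity
  · refine ⟨?_, Polynomial.C 1, by simp, fun v hv => by rw [gaussianMoment_C a 1 hv, one_mul]⟩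
    refine ContDiffOn.mul ?_ (contDiffOn_const.mul contDiffOn_parallel).neg.exp
    refine ContDiffOn.sqrt (ContDiffOn.div contDiffOn_const (by fun_prop)
      fun v hv => (add_pos hv.1 hv.2).ne') fun v hv => ?_
    exact (div_pos Real.pi_pos (add_pos hv.1 hv.2)).ne'

lemma completelyMonotoneAlong_add_rpow {γ c : ℝ} (hγ : 0 ≤ γ) (hc : 0 ≤ c) :
    CompletelyMonotoneAlong quadrant (fun v : ℝ × ℝ => c * (v.1 + v.2) ^ (-γ)) quadrant := by
  refine CompletelyMonotoneAlong.of_family_single isOpen_quadrant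
    {F | ContDiffOn ℝ (⊤ : ℕ∞) F quadrant ∧ ∃ γ c : ℝ, 0 ≤ γ ∧ 0 ≤ c ∧
      Set.EqOn F (fun v => c * (v.1 + v.2) ^ (-γ)) quadrant} (fun F hF => hF.1) ?_ ?_ ?_ _ ?_
  · rintro F ⟨-, γ, c, hγ, hc, hF⟩ v hv
    rw [hF hv]
    exact mul_nonneg hc (Real.rpow_nonneg (add_pos hv.1 hv.2).le _)
  · exact ⟨contDiffOn_const, 0, 0, le_rfl, le_rfl, fun v _ => by simp⟩
  · rintro F ⟨hF, γ, c, hγ, hc, hFe⟩ u hu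
    have hu' : 0 ≤ u.1 + u.2 := (add_pos hu.1 hu.2).le
    refine ⟨hF.negDeriv isOpen_quadrant u, γ + 1, c * γ * (u.1 + u.2), by positivity,
      by positivity, fun v hv => (hFe.negDeriv isOpen_quadrant u hv).trans ?_⟩
    have h1 : HasFDerivAt (fun v : ℝ × ℝ => v.1 + v.2)
        (ContinuousLinearMap.fst ℝ ℝ ℝ + ContinuousLinearMap.snd ℝ ℝ ℝ) v :=
      hasFDerivAt_fst.add hasFDerivAt_snd
    have h2 := (h1.rpow_const (p := -γ) (Or.inl (add_pos hv.1 hv.2).ne')).const_mul c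
    rw [negDeriv, h2.fderiv, show -γ - 1 = -(γ + 1) by ring]
    simp
    ring
  · exact ⟨contDiffOn_const.mul (contDiffOn_add_rpow _), γ, c, hγ, hc, fun v _ => rfl⟩

lemma completelyMonotoneAlong_exp_parallel {β τ : ℝ} (hβ : 1 / 2 ≤ β) (hτ : 0 ≤ τ) :
    CompletelyMonotoneAlong quadrant (fun v : ℝ × ℝ =>
      (v.1 + v.2) ^ (-β) * Real.exp (-(τ * (v.1 * v.2 / (v.1 + v.2))))) quadrant := by
  refine ((completelyMonotoneAlong_add_rpow (sub_nonneg.2 hβ)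
    (inv_nonneg.2 (Real.sqrt_nonneg Real.pi))).mul isOpen_quadrant
    (completelyMonotoneAlong_gaussian √τ)).congr fun v hv => ?_
  have hs : 0 < v.1 + v.2 := add_pos hv.1 hv.2
  have hpow : (v.1 + v.2) ^ (-β) = (v.1 + v.2) ^ (-(β - 1 / 2)) * (√(v.1 + v.2))⁻¹ := by
    rw [Real.sqrt_eq_rpow, ← Real.rpow_neg hs.le, ← Real.rpow_add hs]
    congr 1; ring
  have hpi : √Real.pi ≠ 0 := (Real.sqrt_pos.2 Real.pi_pos).ne'
  simp only [Pi.mul_apply, Real.sq_sqrt hτ, Real.sqrt_div Real.pi_pos.le, hpow]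
  field_simp

end

/-- The parallel sum `yz/(y+z)`. -/
noncomputable def parallel (v : ℝ × ℝ) : ℝ := v.1 * v.2 / (v.1 + v.2)

/-- If a function is `∑ q j * K j` where the `K j` are successive alternating derivatives of a
function composed with `parallel`, then the coefficients of its negated derivative along `u`
(not counting derivatives in further variables) are `diffCoeff u q`. -/
noncomputable def diffCoeff (u : ℝ × ℝ) (q : ℕ → ℝ × ℝ → ℝ) : ℕ → ℝ × ℝ → ℝ
  | 0 => negDeriv u (q 0)
  | j + 1 => negDeriv u (q (j + 1)) + fun v => -negDeriv u parallel v * q j v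

lemma contDiffOn_diffCoeff {q : ℕ → ℝ × ℝ → ℝ}
    (hq : ∀ j, ContDiffOn ℝ (⊤ : ℕ∞) (q j) quadrant) (u : ℝ × ℝ) (j : ℕ) :
    ContDiffOn ℝ (⊤ : ℕ∞) (diffCoeff u q j) quadrant := by
  cases j with
  | zero => exact (hq 0).negDeriv isOpen_quadrant u
  | succ j =>
    exact ((hq (j + 1)).negDeriv isOpen_quadrant u).add
      ((ContDiffOn.negDeriv isOpen_quadrant contDiffOn_parallel u).neg.mul (hq j))

lemma diffCoeff_eq_zero {q : ℕ → ℝ × ℝ → ℝ} {d : ℕ} (hq : ∀ j, d ≤ j → q j = 0) (u : ℝ × ℝ)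
    (j : ℕ) (hj : d + 1 ≤ j) : diffCoeff u q j = 0 := by
  obtain ⟨j, rfl⟩ : ∃ i, j = i + 1 := ⟨j - 1, by omega⟩
  ext v
  simp [diffCoeff, hq j (by omega), hq (j + 1) (by omega), negDeriv]

lemma sum_diffCoeff_mul {q : ℕ → ℝ × ℝ → ℝ} {d : ℕ} (hq : ∀ j, d ≤ j → q j = 0) (u v : ℝ × ℝ)
    (k : ℕ → ℝ) :
    ∑ j ∈ Finset.range (d + 1), diffCoeff u q j v * k j =
      ∑ j ∈ Finset.range d,
        (negDeriv u (q j) v * k j - negDeriv u parallel v * q j v * k (j + 1)) := by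
  have h0 : negDeriv u (q d) v = 0 := by simp [negDeriv, hq d le_rfl]
  have h1 : ∑ j ∈ Finset.range d, negDeriv u (q j) v * k j =
      ∑ j ∈ Finset.range (d + 1), negDeriv u (q j) v * k j := by
    rw [Finset.sum_range_succ, h0, zero_mul, add_zero]
  rw [Finset.sum_sub_distrib, h1, Finset.sum_range_succ', Finset.sum_range_succ']
  have h2 : ∀ j ∈ Finset.range d, diffCoeff u q (j + 1) v * k (j + 1) =
      negDeriv u (q (j + 1)) v * k (j + 1) - negDeriv u parallel v * q j v * k (j + 1) := by
    intro j _
    simp only [diffCoeff, Pi.add_apply]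
    ring
  rw [Finset.sum_congr rfl h2, Finset.sum_sub_distrib]
  simp only [diffCoeff]
  ring

lemma negDeriv_sum_mul_exp {q : ℕ → ℝ × ℝ → ℝ} {d : ℕ}
    (hq : ∀ j, ContDiffOn ℝ (⊤ : ℕ∞) (q j) quadrant) (hq0 : ∀ j, d ≤ j → q j = 0) (τ : ℝ)
    (u : ℝ × ℝ) {v : ℝ × ℝ} (hv : v ∈ quadrant) :
    negDeriv u (fun v => ∑ j ∈ Finset.range d,
      q j v * (τ ^ j * Real.exp (-(τ * parallel v)))) v =
      ∑ j ∈ Finset.range (d + 1),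
        diffCoeff u q j v * (τ ^ j * Real.exp (-(τ * parallel v))) := by
  have hw : HasFDerivAt parallel (fderiv ℝ parallel v) v :=
    contDiffOn_parallel.hasFDerivAt_of_isOpen isOpen_quadrant hv
  have h := HasFDerivAt.fun_sum (u := Finset.range d) (fun j _ =>
    ((hq j).hasFDerivAt_of_isOpen isOpen_quadrant hv).mul
      ((hw.const_mul τ).fun_neg.exp.const_mul (τ ^ j)))
  rw [sum_diffCoeff_mul hq0]
  conv_lhs => rw [negDeriv]
  erw [h.fderiv]
  rw [_root_.sum_apply, ← Finset.sum_neg_distrib]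
  refine Finset.sum_congr rfl fun j _ => ?_
  simp [negDeriv]
  ring

section
variable {V : Type*} [NormedAddCommGroup V] [NormedSpace ℝ V] {C : Set V}

lemma hasFDerivAt_prodMk_parallel {p : V × (ℝ × ℝ)} (hp : p.2 ∈ quadrant) :
    HasFDerivAt (fun p : V × (ℝ × ℝ) => (p.1, parallel p.2))
      ((ContinuousLinearMap.fst ℝ V (ℝ × ℝ)).prod
        ((fderiv ℝ parallel p.2).comp (ContinuousLinearMap.snd ℝ V (ℝ × ℝ)))) p := by
  have hw : HasFDerivAt parallel (fderiv ℝ parallel p.2) p.2 :=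
    contDiffOn_parallel.hasFDerivAt_of_isOpen isOpen_quadrant hp
  exact hasFDerivAt_fst.prodMk (hw.comp p hasFDerivAt_snd)

lemma parallel_pos {v : ℝ × ℝ} (hv : v ∈ quadrant) : 0 < parallel v :=
  div_pos (mul_pos hv.1 hv.2) (add_pos hv.1 hv.2)

lemma negDeriv_sum_mul_parallel (hC : IsOpen C) {q : ℕ → ℝ × ℝ → ℝ} {d : ℕ}
    (hq : ∀ j, ContDiffOn ℝ (⊤ : ℕ∞) (q j) quadrant) (hq0 : ∀ j, d ≤ j → q j = 0)
    {K : ℕ → V × ℝ → ℝ} (hK : ∀ j, ContDiffOn ℝ (⊤ : ℕ∞) (K j) (C ×ˢ Set.Ioi (0 : ℝ)))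
    (hKs : ∀ j, Set.EqOn (K (j + 1)) (negDeriv (0, 1) (K j)) (C ×ˢ Set.Ioi (0 : ℝ)))
    (u : V × (ℝ × ℝ)) {p : V × (ℝ × ℝ)} (hp : p ∈ C ×ˢ quadrant) :
    negDeriv u (fun p : V × (ℝ × ℝ) => ∑ j ∈ Finset.range d,
      q j p.2 * K j (p.1, parallel p.2)) p =
      ∑ j ∈ Finset.range d, q j p.2 * negDeriv (u.1, 0) (K j) (p.1, parallel p.2) +
      ∑ j ∈ Finset.range (d + 1), diffCoeff u.2 q j p.2 * K j (p.1, parallel p.2) := by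
  have hΩ : (p.1, parallel p.2) ∈ C ×ˢ Set.Ioi (0 : ℝ) := ⟨hp.1, parallel_pos hp.2⟩
  have h := HasFDerivAt.fun_sum (u := Finset.range d) (fun j _ =>
    (((hq j).hasFDerivAt_of_isOpen isOpen_quadrant hp.2).comp p hasFDerivAt_snd).mul
      (((hK j).hasFDerivAt_of_isOpen (hC.prod isOpen_Ioi) hΩ).comp p
        (hasFDerivAt_prodMk_parallel hp.2)))
  rw [sum_diffCoeff_mul hq0, ← Finset.sum_add_distrib]
  conv_lhs => rw [negDeriv]
  erw [h.fderiv]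
  rw [_root_.sum_apply, ← Finset.sum_neg_distrib]
  refine Finset.sum_congr rfl fun j _ => ?_
  rw [hKs j hΩ]
  have hsplit : ((u.1, fderiv ℝ parallel p.2 u.2) : V × ℝ) =
      (u.1, 0) + (fderiv ℝ parallel p.2 u.2) • ((0, 1) : V × ℝ) := by simp
  simp [negDeriv]
  rw [hsplit, map_add, map_smul]
  simp
  ring

lemma zero_mem_closure_of_cone (hne : C.Nonempty) (hcone : ∀ x ∈ C, ∀ t : ℝ, 0 < t → t • x ∈ C) :
    (0 : V) ∈ closure C := by
  obtain ⟨x, hx⟩ := hne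
  have h : Tendsto (fun t : ℝ => t • x) (𝓝[>] 0) (𝓝 ((0 : ℝ) • x)) :=
    tendsto_nhdsWithin_of_tendsto_nhds (Continuous.tendsto (by fun_prop) 0)
  rw [zero_smul] at h
  refine mem_closure_of_tendsto h ?_
  filter_upwards [self_mem_nhdsWithin] with t ht using hcone x hx t ht

lemma sum_mul_parallel_nonneg (hC : IsOpen C) {p : ℕ → ℝ} {d : ℕ}
    (hp : ∀ τ, 0 ≤ τ → 0 ≤ ∑ j ∈ Finset.range d, p j * τ ^ j)
    {K : ℕ → V × ℝ → ℝ} {U : Set (V × ℝ)}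
    (hK : ∀ j, CompletelyMonotoneAlong U (K j) (C ×ˢ Set.Ioi (0 : ℝ)))
    (hKs : ∀ j, Set.EqOn (K (j + 1)) (negDeriv (0, 1) (K j)) (C ×ˢ Set.Ioi (0 : ℝ)))
    {x : V} (hx : x ∈ C) {t : ℝ} (ht : 0 < t) :
    0 ≤ ∑ j ∈ Finset.range d, p j * K j (x, t) := by
  refine sum_mul_alternating_nonneg (h := fun j t => K j (x, t))
    (fun j t ht => (hK j).nonneg (Set.mk_mem_prod hx ht)) (fun j t ht => ?_) ht hp
  have h1 := (hK j).1.hasFDerivAt_of_isOpen (hC.prod isOpen_Ioi) (x := (x, t)) ⟨hx, ht⟩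
  have h2 : HasDerivAt (fun t : ℝ => (x, t)) ((0 : V), (1 : ℝ)) t :=
    (hasDerivAt_const t x).prodMk (hasDerivAt_id t)
  refine (h1.comp_hasDerivAt t h2).congr_deriv ?_
  rw [hKs j (Set.mk_mem_prod hx ht)]
  simp [negDeriv]

lemma completelyMonotoneAlong_mul_parallel (hne : C.Nonempty) (hC : IsOpen C)
    (hcone : ∀ x ∈ C, ∀ t : ℝ, 0 < t → t • x ∈ C) {f : V × ℝ → ℝ}
    (hf : CompletelyMonotoneAlong (C ×ˢ Set.Ioi (0 : ℝ)) f (C ×ˢ Set.Ioi (0 : ℝ)))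
    {c : ℝ × ℝ → ℝ} (hc : ContDiffOn ℝ (⊤ : ℕ∞) c quadrant)
    (hcexp : ∀ τ : ℝ, 0 ≤ τ → CompletelyMonotoneAlong quadrant
      (fun v => c v * Real.exp (-(τ * parallel v))) quadrant) :
    CompletelyMonotoneAlong (C ×ˢ quadrant)
      (fun p : V × (ℝ × ℝ) => c p.2 * f (p.1, parallel p.2)) (C ×ˢ quadrant) := by
  set Ω : Set (V × ℝ) := C ×ˢ Set.Ioi (0 : ℝ) with hΩ
  have hΩo : IsOpen Ω := hC.prod isOpen_Ioi
  have hclosure : closure Ω = closure C ×ˢ Set.Ici (0 : ℝ) := by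
    rw [hΩ, closure_prod_eq, closure_Ioi]
  have hdir : ((0, 1) : V × ℝ) ∈ closure Ω := by
    rw [hclosure]
    exact ⟨zero_mem_closure_of_cone hne hcone, Set.mem_Ici.2 zero_le_one⟩
  refine CompletelyMonotoneAlong.of_family (hC.prod isOpen_quadrant)
    {F | ∃ (d : ℕ) (q : ℕ → ℝ × ℝ → ℝ) (K : ℕ → V × ℝ → ℝ),
      (∀ j, ContDiffOn ℝ (⊤ : ℕ∞) (q j) quadrant) ∧ (∀ j, d ≤ j → q j = 0) ∧
      (∀ τ : ℝ, 0 ≤ τ → CompletelyMonotoneAlong quadrant (fun v => ∑ j ∈ Finset.range d,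
        q j v * (τ ^ j * Real.exp (-(τ * parallel v)))) quadrant) ∧
      (∀ j, CompletelyMonotoneAlong (closure Ω) (K j) Ω) ∧
      (∀ j, Set.EqOn (K (j + 1)) (negDeriv (0, 1) (K j)) Ω) ∧
      F = fun p => ∑ j ∈ Finset.range d, q j p.2 * K j (p.1, parallel p.2)} ?_ ?_ ?_ _ ?_
  · rintro _ ⟨d, q, K, hq, hq0, hqτ, hK, hKs, rfl⟩
    refine ContDiffOn.sum fun j _ => ContDiffOn.mul ?_ ?_
    · exact (hq j).comp contDiffOn_snd fun p hp => hp.2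
    · refine (hK j).1.comp (contDiffOn_fst.prodMk
        (contDiffOn_parallel.comp contDiffOn_snd fun p hp => hp.2)) fun p hp => ?_
      exact ⟨hp.1, parallel_pos hp.2⟩
  · rintro _ ⟨d, q, K, hq, hq0, hqτ, hK, hKs, rfl⟩ p hp
    refine sum_mul_parallel_nonneg hC (fun τ hτ => ?_) hK hKs hp.1 (parallel_pos hp.2)
    have h := (hqτ τ hτ).nonneg hp.2
    simp only [← mul_assoc, ← Finset.sum_mul] at h
    exact nonneg_of_mul_nonneg_left h (Real.exp_pos _)
  · rintro _ ⟨d, q, K, hq, hq0, hqτ, hK, hKs, rfl⟩ u hu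
    have hu1 : ((u.1, 0) : V × ℝ) ∈ closure Ω := by
      rw [hclosure]
      exact ⟨subset_closure hu.1, Set.self_mem_Ici⟩
    refine ⟨_, ⟨d, q, fun j => negDeriv (u.1, 0) (K j), hq, hq0, hqτ,
      fun j => (hK j).negDeriv hΩo hu1, fun j => ?_, rfl⟩,
      _, ⟨d + 1, diffCoeff u.2 q, K, contDiffOn_diffCoeff hq u.2, diffCoeff_eq_zero hq0 u.2,
      fun τ hτ => ?_, hK, hKs, rfl⟩, fun p hp => ?_⟩
    · exact ((hKs j).negDeriv hΩo _).trans (negDeriv_comm hΩo (hK j).1 _ _)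
    · exact ((hqτ τ hτ).negDeriv isOpen_quadrant hu.2).congr fun v hv =>
        (negDeriv_sum_mul_exp hq hq0 τ u.2 hv).symm
    · exact negDeriv_sum_mul_parallel hC hq hq0 (fun j => (hK j).1) hKs u hp
  · have hK : ∀ j, CompletelyMonotoneAlong (closure Ω) ((negDeriv (0, 1))^[j] f) Ω := by
      intro j
      induction j with
      | zero => exact hf.closure_directions
      | succ j ih =>
        rw [Function.iterate_succ_apply']
        exact ih.negDeriv hΩo hdir
    refine ⟨1, fun j => if j = 0 then c else 0, fun j => (negDeriv (0, 1))^[j] f,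
      fun j => ?_, fun j hj => ?_, fun τ hτ => ?_, hK, fun j => ?_, ?_⟩
    · dsimp only
      split_ifs
      exacts [hc, contDiffOn_const]
    · exact if_neg (by omega)
    · simpa using hcexp τ hτ
    · simp only [Function.iterate_succ_apply']
      exact fun _ _ => rfl
    · simp
end

/-- analytic series extension of a single edge.  Let `C` be an open
convex cone in a finite-dimensional real vector space `V`, let `f` be completely monotone
on `C × (0,∞)` and let `β ≥ 1/2`.  Then `g(x,y,z) = (y+z)^{-β} f(x, yz/(y+z))` is
completely monotone on `C × (0,∞)²`. -/
theorem completely_monotone_series_extension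
    {V : Type*} [NormedAddCommGroup V] [NormedSpace ℝ V] [FiniteDimensional ℝ V]
    (C : Set V) (hne : C.Nonempty) (hopen : IsOpen C) (hconv : Convex ℝ C)
    (hcone : ∀ x ∈ C, ∀ t : ℝ, 0 < t → t • x ∈ C)
    (f : V × ℝ → ℝ)
    (hf : CompletelyMonotoneOn f (C ×ˢ Set.Ioi (0 : ℝ)))
    (β : ℝ) (hβ : (1 : ℝ) / 2 ≤ β) :
    CompletelyMonotoneOn
      (fun p : V × (ℝ × ℝ) =>
        (p.2.1 + p.2.2) ^ (-β) * f (p.1, p.2.1 * p.2.2 / (p.2.1 + p.2.2)))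
      (C ×ˢ (Set.Ioi (0 : ℝ) ×ˢ Set.Ioi (0 : ℝ))) :=
  completelyMonotoneAlong_mul_parallel hne hopen hcone hf (contDiffOn_add_rpow (-β))
    fun _ hτ => completelyMonotoneAlong_exp_parallel hβ hτ
end

section
/- For every real β > 1/2 and all x_1, x_2, x_3 > 0, the following Laplace-transform identity holds: (x_1x_2 + x_1x_3 + x_2x_3)^{-β} = [4^{1−β} / (Γ(1/2) Γ(β−1/2) Γ(β))] · ∫∫∫_{(0,∞)^3} e^{−t_1x_1 − t_2x_2 − t_3x_3} · max(P(t_1,t_2,t_3), 0)^{β−3/2} dt_1 dt_2 dt_3, where P(t_1,t_2,t_3) = 2(t_1t_2 + t_1t_3 + t_2t_3) − (t_1^2 + t_2^2 + t_3^2), and the integrand is interpreted as 0 at points where P(t_1,t_2,t_3) ≤ 0. -/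
open Real MeasureTheory

/-- `P(t₁,t₂,t₃) = 2(t₁t₂ + t₁t₃ + t₂t₃) − (t₁² + t₂² + t₃²)`, which is 16 times the
squared area of a triangle with sides `√t₁, √t₂, √t₃` (Heron's formula). -/
def heronP (t₁ t₂ t₃ : ℝ) : ℝ :=
  2 * (t₁ * t₂ + t₁ * t₃ + t₂ * t₃) - (t₁ ^ 2 + t₂ ^ 2 + t₃ ^ 2)

/-- The integrand `exp (-(t a + y b + w c)) (4 t y - w²)₊ ^ p` obtained from the triple Laplace
integrand by the shift `w = t₃ - t₁ - t₂`. -/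
noncomputable def shiftedIntegrand (p t a b c y w : ℝ) : ℝ :=
  Real.exp (-(t * a + y * b + w * c)) *
    (if 0 < 4 * t * y - w ^ 2 then (4 * t * y - w ^ 2) ^ p else 0)

theorem shiftedIntegrand_nonneg (p t a b c y w : ℝ) : 0 ≤ shiftedIntegrand p t a b c y w := by
  unfold shiftedIntegrand
  split_ifs with h
  · positivity
  · simp

theorem measurable_uncurry_shiftedIntegrand (p t a b c : ℝ) :
    Measurable (Function.uncurry (shiftedIntegrand p t a b c)) := by
  unfold shiftedIntegrand Function.uncurry
  refine Measurable.mul (by fun_prop) (Measurable.ite ?_ (by fun_prop) (by fun_prop))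
  exact measurableSet_lt (by fun_prop) (by fun_prop)

theorem pos_of_heronP_pos {t y z : ℝ} (ht : 0 < t) (h : 0 < heronP t y z) : 0 < y := by
  unfold heronP at h
  have : 0 < t * y := by nlinarith [sq_nonneg (z - t - y)]
  exact pos_of_mul_pos_right this ht.le

theorem heronP_swap (t y z : ℝ) : heronP t y z = heronP t z y := by
  unfold heronP
  ring

/-- The shifted integral of a truncated power against an exponential. -/
theorem integral_shiftedIntegrand_left {p t a b c : ℝ} (hp : -1 < p) (ht : 0 < t) (hb : 0 < b)
    (w : ℝ) :
    ∫ y, shiftedIntegrand p t a b c y w =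
      (4 * t) ^ p * ((1 / b) ^ (p + 1) * Real.Gamma (p + 1)) * Real.exp (-(t * a)) *
        Real.exp (-(b / (4 * t) * w ^ 2 + w * c)) := by
  rw [← integral_add_right_eq_self _ (w ^ 2 / (4 * t))]
  have key : ∀ v, shiftedIntegrand p t a b c (v + w ^ 2 / (4 * t)) w =
      (Set.Ioi (0 : ℝ)).indicator (fun v => ((4 * t) ^ p * Real.exp (-(t * a)) *
        Real.exp (-(b / (4 * t) * w ^ 2 + w * c))) *
          (v ^ (p + 1 - 1) * Real.exp (-(b * v)))) v := by
    intro v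
    have h4 : 4 * t * (v + w ^ 2 / (4 * t)) - w ^ 2 = 4 * t * v := by
      field_simp
      ring
    unfold shiftedIntegrand
    rw [h4]
    by_cases hv : 0 < v
    · have h4v : 0 < 4 * t * v := by positivity
      have hexp : Real.exp (-(t * a + (v + w ^ 2 / (4 * t)) * b + w * c)) =
          Real.exp (-(t * a)) * Real.exp (-(b / (4 * t) * w ^ 2 + w * c)) *
            Real.exp (-(b * v)) := by
        rw [← Real.exp_add, ← Real.exp_add]
        congr 1
        ring
      rw [if_pos h4v, Set.indicator_of_mem (Set.mem_Ioi.mpr hv), hexp,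
        Real.mul_rpow (by positivity) hv.le, add_sub_cancel_right]
      ring
    · have h4v : ¬ 0 < 4 * t * v := by
        intro h
        exact hv (pos_of_mul_pos_right h (by positivity))
      rw [if_neg h4v, Set.indicator_of_notMem (by simpa using hv), mul_zero]
  simp_rw [key]
  rw [integral_indicator measurableSet_Ioi, integral_const_mul,
    Real.integral_rpow_mul_exp_neg_mul_Ioi (by linarith) hb]
  ring

theorem integral_exp_neg_sq_add_linear {k : ℝ} (hk : 0 < k) (c : ℝ) :
    ∫ w : ℝ, Real.exp (-(k * w ^ 2 + w * c)) =
      Real.sqrt (π / k) * Real.exp (c ^ 2 / (4 * k)) := by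
  have key : ∀ w : ℝ, Real.exp (-(k * (w + -(c / (2 * k))) ^ 2 + (w + -(c / (2 * k))) * c)) =
      Real.exp (-k * w ^ 2) * Real.exp (c ^ 2 / (4 * k)) := by
    intro w
    rw [← Real.exp_add]
    congr 1
    field_simp
    ring
  rw [← integral_add_right_eq_self _ (-(c / (2 * k)))]
  simp_rw [key]
  rw [integral_mul_const, integral_gaussian]

theorem integral_integral_shiftedIntegrand {p t a b c : ℝ} (hp : -1 < p) (ht : 0 < t)
    (hb : 0 < b) :
    ∫ y, ∫ w, shiftedIntegrand p t a b c y w =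
      (4 * t) ^ p * ((1 / b) ^ (p + 1) * Real.Gamma (p + 1)) * Real.exp (-(t * a)) *
        (Real.sqrt (π / (b / (4 * t))) * Real.exp (c ^ 2 / (4 * (b / (4 * t))))) := by
  have hΓ : 0 < Real.Gamma (p + 1) := Real.Gamma_pos_of_pos (by linarith)
  have hk : 0 < b / (4 * t) := by positivity
  have hval : ∫ w, ∫ y, shiftedIntegrand p t a b c y w =
      (4 * t) ^ p * ((1 / b) ^ (p + 1) * Real.Gamma (p + 1)) * Real.exp (-(t * a)) *
        (Real.sqrt (π / (b / (4 * t))) * Real.exp (c ^ 2 / (4 * (b / (4 * t))))) := by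
    simp_rw [integral_shiftedIntegrand_left hp ht hb]
    rw [integral_const_mul, integral_exp_neg_sq_add_linear hk]
  rw [← hval]
  refine integral_integral_swap ?_
  refine (integrable_prod_iff'
    (measurable_uncurry_shiftedIntegrand p t a b c).aestronglyMeasurable).2 ⟨?_, ?_⟩
  · refine Filter.Eventually.of_forall fun w => Integrable.of_integral_ne_zero ?_
    simp only [Function.uncurry_apply_pair]
    rw [integral_shiftedIntegrand_left hp ht hb]
    positivity
  · simp only [Function.uncurry_apply_pair, Real.norm_of_nonneg (shiftedIntegrand_nonneg ..)]
    refine Integrable.of_integral_ne_zero ?_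
    rw [hval]
    positivity

theorem integral_integral_heronP {p t : ℝ} (hp : -1 < p) (ht : 0 < t) {x₁ x₂ x₃ : ℝ}
    (hb : 0 < x₂ + x₃) :
    ∫ t₂ in Set.Ioi (0 : ℝ), ∫ t₃ in Set.Ioi (0 : ℝ),
        Real.exp (-(t * x₁ + t₂ * x₂ + t₃ * x₃)) *
          (if 0 < heronP t t₂ t₃ then heronP t t₂ t₃ ^ p else 0) =
      4 ^ p * 2 * Real.sqrt π * Real.Gamma (p + 1) * (x₂ + x₃) ^ (-(p + 3 / 2)) *
        (t ^ (p + 3 / 2 - 1) *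
          Real.exp (-((x₁ * x₂ + x₁ * x₃ + x₂ * x₃) / (x₂ + x₃) * t))) := by
  have hinner : ∀ t₂, ∫ t₃ in Set.Ioi (0 : ℝ), Real.exp (-(t * x₁ + t₂ * x₂ + t₃ * x₃)) *
          (if 0 < heronP t t₂ t₃ then heronP t t₂ t₃ ^ p else 0) =
      ∫ w, shiftedIntegrand p t (x₁ + x₃) (x₂ + x₃) x₃ t₂ w := by
    intro t₂
    rw [setIntegral_eq_integral_of_forall_compl_eq_zero,
      ← integral_add_right_eq_self _ (t + t₂)]
    · refine integral_congr_ae (Filter.Eventually.of_forall fun w => ?_)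
      have hP : heronP t t₂ (w + (t + t₂)) = 4 * t * t₂ - w ^ 2 := by
        unfold heronP
        ring
      simp only [shiftedIntegrand, hP]
      congr 2
      ring
    · intro z hz
      rw [if_neg fun h => hz (pos_of_heronP_pos ht (heronP_swap t t₂ z ▸ h)), mul_zero]
  simp_rw [hinner]
  rw [setIntegral_eq_integral_of_forall_compl_eq_zero,
    integral_integral_shiftedIntegrand hp ht hb]
  · have hsqrt : Real.sqrt (π / ((x₂ + x₃) / (4 * t))) =
        2 * Real.sqrt π * (t ^ (1 / 2 : ℝ) * (x₂ + x₃) ^ (-(1 / 2) : ℝ)) := by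
      rw [show π / ((x₂ + x₃) / (4 * t)) = 2 ^ 2 * (π * (t * (x₂ + x₃)⁻¹)) by field_simp; ring,
        Real.sqrt_mul (by positivity), Real.sqrt_sq (by norm_num), Real.sqrt_mul pi_pos.le,
        Real.sqrt_eq_rpow (t * _), Real.mul_rpow ht.le (by positivity),
        Real.inv_rpow hb.le, Real.rpow_neg hb.le]
      ring
    have hexp : Real.exp (-((x₁ * x₂ + x₁ * x₃ + x₂ * x₃) / (x₂ + x₃) * t)) =
        Real.exp (-(t * (x₁ + x₃))) *
          Real.exp (x₃ ^ 2 / (4 * ((x₂ + x₃) / (4 * t)))) := by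
      rw [← Real.exp_add]
      congr 1
      field_simp
      ring
    have ht' : t ^ (p + 3 / 2 - 1) = t ^ p * t ^ (1 / 2 : ℝ) := by
      rw [← Real.rpow_add ht]
      congr 1
      ring
    have hb' : (x₂ + x₃) ^ (-(p + 3 / 2)) =
        (1 / (x₂ + x₃)) ^ (p + 1) * (x₂ + x₃) ^ (-(1 / 2) : ℝ) := by
      rw [one_div, Real.inv_rpow hb.le, ← Real.rpow_neg hb.le, ← Real.rpow_add hb]
      congr 1
      ring
    rw [hsqrt, hexp, ht', hb', Real.mul_rpow (by norm_num) ht.le]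
    ring
  · intro y hy
    rw [← hinner]
    refine integral_eq_zero_of_ae (Filter.Eventually.of_forall fun z => ?_)
    simp only [Pi.zero_apply]
    rw [if_neg fun h => hy (pos_of_heronP_pos ht h), mul_zero]

/-- For `β > 1/2` and `x₁, x₂, x₃ > 0`,
`(x₁x₂ + x₁x₃ + x₂x₃)^{-β}` equals
`4^{1−β}/(Γ(1/2)Γ(β−1/2)Γ(β))` times the triple Laplace integral of
`max(P,0)^{β−3/2}` (the integrand being `0` where `P ≤ 0`). -/
theorem laplace_transform_inverse_power_E23
    (β : ℝ) (hβ : (1 : ℝ) / 2 < β)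
    (x₁ x₂ x₃ : ℝ) (hx₁ : 0 < x₁) (hx₂ : 0 < x₂) (hx₃ : 0 < x₃) :
    (x₁ * x₂ + x₁ * x₃ + x₂ * x₃) ^ (-β) =
      (4 : ℝ) ^ (1 - β) /
          (Real.Gamma (1 / 2) * Real.Gamma (β - 1 / 2) * Real.Gamma β) *
        ∫ t₁ in Set.Ioi (0 : ℝ), ∫ t₂ in Set.Ioi (0 : ℝ), ∫ t₃ in Set.Ioi (0 : ℝ),
          Real.exp (-(t₁ * x₁ + t₂ * x₂ + t₃ * x₃)) *
            (if 0 < heronP t₁ t₂ t₃ then heronP t₁ t₂ t₃ ^ (β - 3 / 2) else 0) := by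
  have hb : 0 < x₂ + x₃ := by positivity
  have hQ : 0 < x₁ * x₂ + x₁ * x₃ + x₂ * x₃ := by positivity
  have hβ0 : 0 < β := by linarith
  have hΓ₁ : 0 < Real.Gamma β := Real.Gamma_pos_of_pos hβ0
  have hΓ₂ : 0 < Real.Gamma (β - 1 / 2) := Real.Gamma_pos_of_pos (by linarith)
  have hπ : 0 < Real.sqrt π := Real.sqrt_pos.2 pi_pos
  rw [setIntegral_congr_fun measurableSet_Ioi fun t ht =>
    integral_integral_heronP (p := β - 3 / 2) (by linarith) (Set.mem_Ioi.mp ht) hb]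
  rw [integral_const_mul, sub_add_cancel,
    Real.integral_rpow_mul_exp_neg_mul_Ioi hβ0 (by positivity), Real.Gamma_one_half_eq,
    show β - 3 / 2 + 1 = β - 1 / 2 by ring, one_div_div, Real.div_rpow hb.le hQ.le,
    Real.rpow_neg hb.le, Real.rpow_neg hQ.le]
  have h4 : (4 : ℝ) ^ (1 - β) * (4 ^ (β - 3 / 2) * 2) = 1 := by
    rw [← mul_assoc, ← Real.rpow_add (by norm_num),
      show 1 - β + (β - 3 / 2) = -(1 / 2 : ℝ) by ring, Real.rpow_neg (by norm_num),
      ← Real.sqrt_eq_rpow, show (4 : ℝ) = 2 ^ 2 by norm_num, Real.sqrt_sq (by norm_num)]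
    norm_num
  have hbβ : 0 < (x₂ + x₃) ^ β := Real.rpow_pos_of_pos hb β
  have hQβ : 0 < (x₁ * x₂ + x₁ * x₃ + x₂ * x₃) ^ β := Real.rpow_pos_of_pos hQ β
  generalize (x₁ * x₂ + x₁ * x₃ + x₂ * x₃) ^ β = q at *
  generalize (x₂ + x₃) ^ β = r at *
  generalize (4 : ℝ) ^ (1 - β) = u at *
  generalize (4 : ℝ) ^ (β - 3 / 2) = v at *
  generalize Real.Gamma β = g at *
  generalize Real.Gamma (β - 1 / 2) = g' at *
  field_simp
  linarith
end

section
/- Let A and B be m×m matrices with entries in a commutative ring R, with rows and columns indexed by {1, …, m}. Then det(A+B) = Σ_{I,J ⊆ {1,…,m}, |I| = |J|} ε(I,J) · det(A_{IJ}) · det(B_{I^c J^c}), where A_{IJ} denotes the submatrix of A with rows I and columns J (kept in their original order), I^c denotes the complement of I in {1,…,m}, and ε(I,J) = (−1)^{Σ_{i∈I} i + Σ_{j∈J} j}. -/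
open Finset Equiv

/-- Applying an adjacent transposition to the sorted list of a finset which does not contain both
of the transposed elements gives again a sorted list. -/
theorem Finset.orderEmbOfFin_swap_apply {m k : ℕ} {p q : Fin m} (hpq : (q : ℕ) = p + 1)
    {s t : Finset (Fin m)} (hs : s.card = k) (ht : t.card = k) (hpqs : ¬(p ∈ s ∧ q ∈ s))
    (hst : ∀ x ∈ s, swap p q x ∈ t) (a : Fin k) :
    t.orderEmbOfFin ht a = swap p q (s.orderEmbOfFin hs a) := by
  refine (congrFun (Finset.orderEmbOfFin_unique ht
    (f := fun a => swap p q (s.orderEmbOfFin hs a))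
    (fun x => hst _ (s.orderEmbOfFin_mem hs x)) fun x y hxy => ?_) a).symm
  have hlt := (s.orderEmbOfFin hs).strictMono hxy
  have hx := s.orderEmbOfFin_mem hs x
  have hy := s.orderEmbOfFin_mem hs y
  beta_reduce
  generalize s.orderEmbOfFin hs x = x' at *
  generalize s.orderEmbOfFin hs y = y' at *
  simp only [swap_apply_def]
  split_ifs <;> grind

/-- A finset of `Fin m` that is closed under predecessors is a lower set. -/
theorem Fin.isLowerSet_of_pred_mem {m : ℕ} {s : Finset (Fin m)}
    (h : ∀ p q : Fin m, (q : ℕ) = p + 1 → q ∈ s → p ∈ s) : IsLowerSet (s : Set (Fin m)) := by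
  have key : ∀ d : ℕ, ∀ a b : Fin m, (a : ℕ) = b + d → a ∈ s → b ∈ s := by
    intro d
    induction d with
    | zero => intro a b hab ha; rwa [← Fin.ext (show (a : ℕ) = b by simpa using hab)]
    | succ d ih =>
      intro a b hab ha
      exact ih ⟨b + d, by omega⟩ b rfl (h _ a (by simp; omega) ha)
  intro a b hba ha
  exact key (a - b) a b (by have : (b : ℕ) ≤ a := hba; omega) ha

/-- Two lower sets of the same cardinality in a linear order are equal. -/
theorem IsLowerSet.finset_eq_of_card_eq {α : Type*} [LinearOrder α] {s t : Finset α}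
    (hs : IsLowerSet (s : Set α)) (ht : IsLowerSet (t : Set α)) (h : s.card = t.card) :
    s = t := by
  rcases hs.total ht with h' | h'
  · exact Finset.eq_of_subset_of_card_le (by exact_mod_cast h') h.ge
  · exact (Finset.eq_of_subset_of_card_le (by exact_mod_cast h') h.le).symm

/-- Exchanging an element of `s` for its absent predecessor composes the sorting bijection
with a transposition. -/
theorem finSumEquivOfFinset_insert_erase {m k l : ℕ} {p q : Fin m} (hpq : (q : ℕ) = p + 1)
    {s : Finset (Fin m)} (hq : q ∈ s) (hp : p ∉ s) (hs : s.card = k) (hs' : sᶜ.card = l)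
    (ht : (insert p (s.erase q)).card = k) (ht' : (insert p (s.erase q))ᶜ.card = l) :
    finSumEquivOfFinset ht ht' = (finSumEquivOfFinset hs hs').trans (swap p q) := by
  ext1 x
  rcases x with a | a
  · simp only [finSumEquivOfFinset_inl, trans_apply]
    exact Finset.orderEmbOfFin_swap_apply hpq hs ht (by tauto)
      (by intro x hx; rw [swap_apply_def]; split_ifs <;> grind) a
  · simp only [finSumEquivOfFinset_inr, trans_apply]
    exact Finset.orderEmbOfFin_swap_apply hpq hs' ht' (by simp [hq])
      (by intro x hx; rw [swap_apply_def]; split_ifs <;> grind [mem_compl]) a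

/-- The sign of the permutation taking the list `I` followed by `Iᶜ` to the list `J` followed
by `Jᶜ`. -/
theorem sign_finSumEquivOfFinset_symm_trans {m k l : ℕ} {I J : Finset (Fin m)}
    (hI : I.card = k) (hI' : Iᶜ.card = l) (hJ : J.card = k) (hJ' : Jᶜ.card = l) :
    Perm.sign ((finSumEquivOfFinset hI hI').symm.trans (finSumEquivOfFinset hJ hJ')) =
      (-1) ^ ((∑ i ∈ I, (i : ℕ)) + ∑ j ∈ J, (j : ℕ)) := by
  induction hn : (∑ i ∈ I, (i : ℕ)) + ∑ j ∈ J, (j : ℕ) using Nat.strong_induction_on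
    generalizing I J with
  | _ n ih =>
  have reduce : ∀ {s : Finset (Fin m)} {p q : Fin m}, (q : ℕ) = p + 1 → q ∈ s → p ∉ s →
      (insert p (s.erase q)).card = s.card ∧
        ∑ i ∈ s, (i : ℕ) = (∑ i ∈ insert p (s.erase q), (i : ℕ)) + 1 := by
    intro s p q hpq hq hp
    have hp' : p ∉ s.erase q := by simp [hp]
    refine ⟨?_, ?_⟩
    · rw [card_insert_of_notMem hp', card_erase_add_one hq]
    · rw [sum_insert hp', ← add_sum_erase s _ hq]
      omega
  by_cases h₁ : ∃ p q : Fin m, (q : ℕ) = p + 1 ∧ q ∈ I ∧ p ∉ I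
  · obtain ⟨p, q, hpq, hq, hp⟩ := h₁
    obtain ⟨hc, hsum⟩ := reduce hpq hq hp
    have hK : (insert p (I.erase q)).card = k := hc.trans hI
    have hK' : (insert p (I.erase q))ᶜ.card = l := by rw [card_compl, hc, ← card_compl, hI']
    have h := ih _ (by omega) hK hK' hJ hJ' rfl
    have hne : p ≠ q := by rintro rfl; omega
    rw [finSumEquivOfFinset_insert_erase hpq hq hp hI hI' hK hK'] at h
    have : (finSumEquivOfFinset hI hI').symm.trans (finSumEquivOfFinset hJ hJ') =
        (swap p q).trans ((((finSumEquivOfFinset hI hI').trans (swap p q)).symm).trans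
          (finSumEquivOfFinset hJ hJ')) := by
      ext1 x; simp
    rw [this, Perm.sign_trans, h, Perm.sign_swap hne, ← hn, hsum, add_right_comm, pow_succ]
  by_cases h₂ : ∃ p q : Fin m, (q : ℕ) = p + 1 ∧ q ∈ J ∧ p ∉ J
  · obtain ⟨p, q, hpq, hq, hp⟩ := h₂
    obtain ⟨hc, hsum⟩ := reduce hpq hq hp
    have hK : (insert p (J.erase q)).card = k := hc.trans hJ
    have hK' : (insert p (J.erase q))ᶜ.card = l := by rw [card_compl, hc, ← card_compl, hJ']
    have h := ih _ (by omega) hI hI' hK hK' rfl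
    have hne : p ≠ q := by rintro rfl; omega
    rw [finSumEquivOfFinset_insert_erase hpq hq hp hJ hJ' hK hK', ← Equiv.trans_assoc,
      Perm.sign_trans, Perm.sign_swap hne] at h
    rw [← hn, hsum, ← add_assoc, pow_succ, ← h]
    simp
  push Not at h₁ h₂
  obtain rfl : I = J := (Fin.isLowerSet_of_pred_mem h₁).finset_eq_of_card_eq
    (Fin.isLowerSet_of_pred_mem h₂) (hI.trans hJ.symm)
  rw [Equiv.symm_trans_self, ← hn, ← two_mul, pow_mul]
  simp

/-- The matrix with entries `A i j` on `I × J`, `B i j` on `Iᶜ × Jᶜ`, and `0` elsewhere. -/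
def Matrix.complementaryBlocks {n R : Type*} [DecidableEq n] [Zero R] (A B : Matrix n n R)
    (I J : Finset n) : Matrix n n R :=
  Matrix.of fun i j => if i ∈ I then (if j ∈ J then A i j else 0) else
    if j ∈ J then 0 else B i j

section

variable {n R : Type*} [DecidableEq n] [Fintype n] [CommRing R]

theorem Matrix.prod_complementaryBlocks (A B : Matrix n n R) (I J : Finset n) (σ : Perm n) :
    ∏ i, A.complementaryBlocks B I J (σ i) i =
      if J.map σ.toEmbedding = I then
        (∏ i ∈ J, A (σ i) i) * ∏ i ∈ Jᶜ, B (σ i) i else 0 := by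
  split_ifs with h
  · subst h
    rw [← prod_mul_prod_compl J]
    congr 1 <;> refine prod_congr rfl fun i hi => ?_ <;>
      simp_all [Matrix.complementaryBlocks]
  · obtain ⟨i, hi⟩ : ∃ i, ¬(i ∈ J ↔ σ i ∈ I) := by
      by_contra! hall
      refine h (Finset.ext fun x => ?_)
      rw [mem_map_equiv, hall, apply_symm_apply]
    refine prod_eq_zero (mem_univ i) ?_
    simp only [Matrix.complementaryBlocks, Matrix.of_apply]
    split_ifs <;> tauto

theorem Matrix.det_add_eq_sum_det_complementaryBlocks (A B : Matrix n n R) :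
    (A + B).det = ∑ I : Finset n, ∑ J : Finset n, (A.complementaryBlocks B I J).det := by
  rw [sum_comm]
  simp only [Matrix.det_apply]
  rw [sum_congr rfl fun J _ => sum_comm, sum_comm]
  refine sum_congr rfl fun σ _ => ?_
  simp only [← smul_sum, Matrix.prod_complementaryBlocks, sum_ite_eq, mem_univ, if_true,
    Matrix.add_apply]
  rw [prod_add, powerset_univ]
  simp only [compl_eq_univ_sdiff]

theorem Matrix.det_complementaryBlocks_of_card_ne (A B : Matrix n n R) {I J : Finset n}
    (h : I.card ≠ J.card) : (A.complementaryBlocks B I J).det = 0 := by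
  rw [Matrix.det_apply]
  refine sum_eq_zero fun σ _ => ?_
  rw [Matrix.prod_complementaryBlocks, if_neg, smul_zero]
  rintro rfl
  exact h (card_map _)

end

theorem Matrix.det_complementaryBlocks {R : Type*} [CommRing R] {m k l : ℕ}
    (A B : Matrix (Fin m) (Fin m) R) {I J : Finset (Fin m)}
    (hI : I.card = k) (hI' : Iᶜ.card = l) (hJ : J.card = k) (hJ' : Jᶜ.card = l) :
    (A.complementaryBlocks B I J).det =
      (-1 : R) ^ ((∑ i ∈ I, (i : ℕ)) + ∑ j ∈ J, (j : ℕ)) *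
        (A.submatrix (I.orderEmbOfFin hI) (J.orderEmbOfFin hJ)).det *
        (B.submatrix (Iᶜ.orderEmbOfFin hI') (Jᶜ.orderEmbOfFin hJ')).det := by
  set e := finSumEquivOfFinset hI hI' with he
  set f := finSumEquivOfFinset hJ hJ' with hf
  have hblock : (A.complementaryBlocks B I J).submatrix e f =
      Matrix.fromBlocks (A.submatrix (I.orderEmbOfFin hI) (J.orderEmbOfFin hJ)) 0 0
        (B.submatrix (Iᶜ.orderEmbOfFin hI') (Jᶜ.orderEmbOfFin hJ')) := by
    have mem {s : Finset (Fin m)} {r : ℕ} (hs : s.card = r) (a : Fin r) :=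
      s.orderEmbOfFin_mem hs a
    have notMem {s : Finset (Fin m)} {r : ℕ} (hs : sᶜ.card = r) (a : Fin r) :=
      mem_compl.1 (sᶜ.orderEmbOfFin_mem hs a)
    ext (a | a) (b | b) <;>
      simp only [he, hf, Matrix.complementaryBlocks, Matrix.submatrix_apply, Matrix.of_apply,
        finSumEquivOfFinset_inl, finSumEquivOfFinset_inr, mem, notMem, if_true, if_false,
        Matrix.fromBlocks_apply₁₁, Matrix.fromBlocks_apply₁₂, Matrix.fromBlocks_apply₂₁,
        Matrix.fromBlocks_apply₂₂, Matrix.zero_apply]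
  have hperm : (A.complementaryBlocks B I J).submatrix e f =
      ((A.complementaryBlocks B I J).submatrix id (e.symm.trans f)).submatrix e e := by
    ext a b
    simp
  have hdet := congrArg Matrix.det hblock
  rw [hperm, Matrix.det_submatrix_equiv_self, Matrix.det_permute',
    sign_finSumEquivOfFinset_symm_trans, Matrix.det_fromBlocks_zero₂₁] at hdet
  rw [mul_assoc, ← hdet, ← mul_assoc]
  simp [← mul_pow]

/-- For `m×m` matrices `A, B` over a commutative ring,
`det(A+B) = Σ_{I,J ⊆ [m], |I|=|J|} ε(I,J) det(A_{IJ}) det(B_{IᶜJᶜ})`, where `A_{IJ}` is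
the submatrix with rows `I` and columns `J` (in increasing order), and
`ε(I,J) = (−1)^{Σ_{i∈I} i + Σ_{j∈J} j}`. -/
theorem det_add_eq_sum_minors {R : Type*} [CommRing R] {m : ℕ}
    (A B : Matrix (Fin m) (Fin m) R) :
    (A + B).det =
      ∑ I : Finset (Fin m), ∑ J : Finset (Fin m),
        if h : I.card = J.card then
          ((-1 : R) ^ ((∑ i ∈ I, (i : ℕ)) + ∑ j ∈ J, (j : ℕ))) *
            (A.submatrix (⇑(I.orderEmbOfFin rfl)) (⇑(J.orderEmbOfFin h.symm))).det *
            (B.submatrix (⇑(Iᶜ.orderEmbOfFin rfl))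
              (⇑(Jᶜ.orderEmbOfFin
                (by rw [Finset.card_compl, Finset.card_compl, h])))).det
        else 0 := by
  rw [Matrix.det_add_eq_sum_det_complementaryBlocks]
  refine Finset.sum_congr rfl fun I _ => Finset.sum_congr rfl fun J _ => ?_
  split_ifs with h
  · exact Matrix.det_complementaryBlocks A B rfl rfl h.symm _
  · exact Matrix.det_complementaryBlocks_of_card_ne A B h
end

section
/- Let A_1, …, A_n be complex hermitian positive-semidefinite m×m matrices, and define P(x_1, …, x_n) = det(Σ_{i=1}^n x_i A_i) as a polynomial in complex variables x_1, …, x_n. Then P has the half-plane property: either P is identically zero, or else P(x_1, …, x_n) ≠ 0 whenever Re x_i > 0 for all i ∈ {1, …, n}. -/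
open scoped ComplexOrder

/-- A vector annihilated by a combination of positive-semidefinite matrices whose coefficients have
positive real part is annihilated by each of the matrices. -/
theorem mulVec_eq_zero_of_sum_smul_mulVec_eq_zero {ι κ : Type*} [Fintype ι] [Fintype κ]
    {A : ι → Matrix κ κ ℂ} (hA : ∀ i, (A i).PosSemidef) {x : ι → ℂ} (hx : ∀ i, 0 < (x i).re)
    {v : κ → ℂ} (hv : Matrix.mulVec (∑ i, x i • A i) v = 0) (i : ι) :
    Matrix.mulVec (A i) v = 0 := by
  have hq i := Complex.nonneg_iff.mp ((hA i).dotProduct_mulVec_nonneg v)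
  have hsum : ∑ i, (x i).re * (star v ⬝ᵥ Matrix.mulVec (A i) v).re = 0 := by
    have h : ∑ i, x i * (star v ⬝ᵥ Matrix.mulVec (A i) v) = 0 := by
      simpa [Matrix.sum_mulVec, dotProduct_sum, Matrix.smul_mulVec] using
        congrArg (star v ⬝ᵥ ·) hv
    simpa [Complex.mul_re, ← (hq _).2] using congrArg Complex.re h
  have hi := (Finset.sum_eq_zero_iff_of_nonneg
    fun i _ ↦ mul_nonneg (hx i).le (hq i).1).mp hsum i (Finset.mem_univ i)
  refine ((hA i).dotProduct_mulVec_zero_iff v).mp (Complex.ext ?_ (hq i).2.symm)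
  exact (mul_eq_zero.mp hi).resolve_left (ne_of_gt (hx i))

/-- Let `A₁, …, Aₙ` be complex hermitian positive-semidefinite `m×m`
matrices and `P(x₁,…,xₙ) = det(Σᵢ xᵢ Aᵢ)`.  Then `P` has the half-plane property: either
`P` is identically zero, or `P(x) ≠ 0` whenever `Re xᵢ > 0` for all `i`. -/
theorem det_linear_combination_half_plane_property
    {n m : ℕ} (A : Fin n → Matrix (Fin m) (Fin m) ℂ)
    (hpsd : ∀ i, (A i).PosSemidef) :
    (∀ x : Fin n → ℂ, (∑ i, x i • A i).det = 0) ∨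
    (∀ x : Fin n → ℂ, (∀ i, 0 < (x i).re) → (∑ i, x i • A i).det ≠ 0) := by
  by_contra! h
  obtain ⟨⟨y, hy⟩, x, hx, hdet⟩ := h
  obtain ⟨v, hv, hxv⟩ := Matrix.exists_mulVec_eq_zero_iff.mpr hdet
  refine hy (Matrix.exists_mulVec_eq_zero_iff.mp ⟨v, hv, ?_⟩)
  simp [Matrix.sum_mulVec, Matrix.smul_mulVec,
    mulVec_eq_zero_of_sum_smul_mulVec_eq_zero hpsd hx hxv]
end

section
/- Let G be a connected finite simple graph with p vertices and edge set E, and let T_G(x) = Σ_{T ∈ 𝒯(G)} Π_{e ∈ T} x_e be its spanning-tree polynomial, where 𝒯(G) is the (nonempty) family of edge sets of spanning trees of G and x = {x_e}_{e∈E}. Then T_G is strictly positive on (0,∞)^E, and T_G^{-β} is completely monotone on (0,∞)^E for every β in the set {0, 1/2, 1, 3/2, …} and for every real β ≥ (p−2)/2. -/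
/-- The open positive orthant `(0,∞)^ι`. -/
def posOrthant (ι : Type*) : Set (ι → ℝ) := {x | ∀ i, 0 < x i}

/-- A function `f : (0,∞)^ι → ℝ` is completely monotone if it is `C^∞` on the open
orthant and `(−1)^k ∂^k f/(∂x_{e_1}···∂x_{e_k}) ≥ 0` there, for every `k ≥ 0` and all
indices `e_1, …, e_k ∈ ι`. -/
def CompletelyMonotoneOnOrthant {ι : Type*} [Fintype ι] [DecidableEq ι]
    (f : (ι → ℝ) → ℝ) : Prop :=
  ContDiffOn ℝ (⊤ : ℕ∞) f (posOrthant ι) ∧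
    ∀ (k : ℕ) (idx : Fin k → ι), ∀ x ∈ posOrthant ι,
      0 ≤ (-1 : ℝ) ^ k *
        iteratedFDerivWithin ℝ k f (posOrthant ι) x (fun j => Pi.single (idx j) (1 : ℝ))

/-- A set `t` of edges of `G` is (the edge set of) a spanning tree if the spanning
subgraph with edge set `t` is connected and acyclic. -/
def IsSpanningTree {V : Type*} (G : SimpleGraph V) (t : Set G.edgeSet) : Prop :=
  (SimpleGraph.fromEdgeSet (Subtype.val '' t)).Connected ∧
    (SimpleGraph.fromEdgeSet (Subtype.val '' t)).IsAcyclic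

open scoped Classical in
/-- The spanning-tree polynomial `T_G(x) = Σ_{T ∈ 𝒯(G)} Π_{e ∈ T} x_e` of `G`. -/
noncomputable def spanningTreePoly {V : Type*} (G : SimpleGraph V)
    [Fintype G.edgeSet] (x : G.edgeSet → ℝ) : ℝ :=
  ∑ t ∈ Finset.univ.filter (fun t : Finset G.edgeSet => IsSpanningTree G ↑t),
    ∏ e ∈ t, x e

open Filter Topology MeasureTheory

theorem isOpen_posOrthant {ι : Type*} [Finite ι] : IsOpen (posOrthant ι) := by
  have : posOrthant ι = Set.pi Set.univ fun _ => Set.Ioi (0 : ℝ) := by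
    ext x; simp [posOrthant]
  rw [this]
  exact isOpen_set_pi Set.finite_univ fun _ _ => isOpen_Ioi

section FiniteDifferences

variable {ι : Type*} [DecidableEq ι]

/-- The first `k` iterated finite differences of `f` with positive steps along the coordinate
axes alternate in sign on the open positive orthant. -/
def AlternatingDifferences : ℕ → ((ι → ℝ) → ℝ) → Prop
  | 0, f => ∀ x ∈ posOrthant ι, 0 ≤ f x
  | k + 1, f => (∀ x ∈ posOrthant ι, 0 ≤ f x) ∧
      ∀ (i : ι) (h : ℝ), 0 < h →
        AlternatingDifferences k (fun x => f x - f (x + Pi.single i h))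

theorem add_single_mem_posOrthant {x : ι → ℝ} (hx : x ∈ posOrthant ι) (i : ι) {h : ℝ}
    (hh : 0 ≤ h) : x + Pi.single i h ∈ posOrthant ι := by
  intro j
  have h1 := hx j
  have h2 : 0 ≤ (Pi.single i h : ι → ℝ) j := by
    by_cases hj : j = i
    · subst hj; simpa using hh
    · simp [hj]
  simp only [Pi.add_apply]
  linarith

namespace AlternatingDifferences

theorem nonneg {k : ℕ} {f : (ι → ℝ) → ℝ} (hf : AlternatingDifferences k f) :
    ∀ x ∈ posOrthant ι, 0 ≤ f x := by
  cases k with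
  | zero => exact hf
  | succ k => exact hf.1

theorem of_succ {k : ℕ} {f : (ι → ℝ) → ℝ} (hf : AlternatingDifferences (k + 1) f) :
    AlternatingDifferences k f := by
  induction k generalizing f with
  | zero => exact hf.1
  | succ k ih => exact ⟨hf.1, fun i h hh => ih (hf.2 i h hh)⟩

theorem congr {k : ℕ} {f g : (ι → ℝ) → ℝ} (hf : AlternatingDifferences k f)
    (hfg : ∀ x ∈ posOrthant ι, f x = g x) : AlternatingDifferences k g := by
  induction k generalizing f g with
  | zero => exact fun x hx => hfg x hx ▸ hf x hx
  | succ k ih =>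
    refine ⟨fun x hx => hfg x hx ▸ hf.1 x hx, fun i h hh => ih (hf.2 i h hh) fun x hx => ?_⟩
    rw [hfg x hx, hfg _ (add_single_mem_posOrthant hx i hh.le)]

theorem const {c : ℝ} (hc : 0 ≤ c) (k : ℕ) :
    AlternatingDifferences k (fun _ : ι → ℝ => c) := by
  induction k generalizing c with
  | zero => exact fun _ _ => hc
  | succ k ih => exact ⟨fun _ _ => hc, fun i h _ => by simpa using ih le_rfl⟩

theorem shift {k : ℕ} {f : (ι → ℝ) → ℝ} (hf : AlternatingDifferences k f) (i : ι) {h : ℝ}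
    (hh : 0 ≤ h) : AlternatingDifferences k (fun x => f (x + Pi.single i h)) := by
  induction k generalizing f with
  | zero => exact fun x hx => hf _ (add_single_mem_posOrthant hx i hh)
  | succ k ih =>
    refine ⟨fun x hx => hf.1 _ (add_single_mem_posOrthant hx i hh), fun j t ht => ?_⟩
    refine (ih (hf.2 j t ht)).congr fun x _ => ?_
    rw [add_right_comm]

theorem add {k : ℕ} {f g : (ι → ℝ) → ℝ} (hf : AlternatingDifferences k f)
    (hg : AlternatingDifferences k g) : AlternatingDifferences k (fun x => f x + g x) := by
  induction k generalizing f g with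
  | zero => exact fun x hx => add_nonneg (hf x hx) (hg x hx)
  | succ k ih =>
    refine ⟨fun x hx => add_nonneg (hf.1 x hx) (hg.1 x hx), fun i h hh => ?_⟩
    exact (ih (hf.2 i h hh) (hg.2 i h hh)).congr fun x _ => by ring

theorem mul {k : ℕ} {f g : (ι → ℝ) → ℝ} (hf : AlternatingDifferences k f)
    (hg : AlternatingDifferences k g) : AlternatingDifferences k (fun x => f x * g x) := by
  induction k generalizing f g with
  | zero => exact fun x hx => mul_nonneg (hf x hx) (hg x hx)
  | succ k ih =>
    refine ⟨fun x hx => mul_nonneg (hf.1 x hx) (hg.1 x hx), fun i h hh => ?_⟩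
    exact ((ih (hf.2 i h hh) hg.of_succ).add
      (ih (hf.of_succ.shift i hh.le) (hg.2 i h hh))).congr fun x _ => by ring

theorem of_tendsto {k : ℕ} {F : ℕ → (ι → ℝ) → ℝ} {f : (ι → ℝ) → ℝ}
    (hF : ∀ n, AlternatingDifferences k (F n))
    (hlim : ∀ x ∈ posOrthant ι, Tendsto (fun n => F n x) atTop (𝓝 (f x))) :
    AlternatingDifferences k f := by
  induction k generalizing F f with
  | zero => exact fun x hx => ge_of_tendsto' (hlim x hx) fun n => hF n x hx
  | succ k ih =>
    refine ⟨fun x hx => ge_of_tendsto' (hlim x hx) fun n => (hF n).1 x hx, fun i h hh => ?_⟩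
    exact ih (fun n => (hF n).2 i h hh) fun x hx =>
      (hlim x hx).sub (hlim _ (add_single_mem_posOrthant hx i hh.le))

theorem integral_exp [Fintype ι] {Y : Type*} [MeasurableSpace Y] {μ : Measure Y}
    {s : Y → ι → ℝ} (hs : ∀ y i, 0 ≤ s y i) {w : Y → ℝ} (hw : ∀ y, 0 ≤ w y)
    (hint : ∀ x ∈ posOrthant ι,
      Integrable (fun y => w y * Real.exp (-∑ i, x i * s y i)) μ) (k : ℕ) :
    AlternatingDifferences k (fun x => ∫ y, w y * Real.exp (-∑ i, x i * s y i) ∂μ) := by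
  have hnn : ∀ w' : Y → ℝ, (∀ y, 0 ≤ w' y) → ∀ x ∈ posOrthant ι,
      0 ≤ ∫ y, w' y * Real.exp (-∑ i, x i * s y i) ∂μ := fun w' hw' x _ =>
    integral_nonneg fun y => mul_nonneg (hw' y) (Real.exp_nonneg _)
  induction k generalizing w with
  | zero => exact hnn w hw
  | succ k ih =>
    refine ⟨hnn w hw, fun i h hh => ?_⟩
    have key : ∀ (x : ι → ℝ) (y : Y), w y * (1 - Real.exp (-(h * s y i))) *
        Real.exp (-∑ j, x j * s y j) = w y * Real.exp (-∑ j, x j * s y j) -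
          w y * Real.exp (-∑ j, (x + Pi.single i h : ι → ℝ) j * s y j) := by
      intro x y
      have : ∑ j, (x + Pi.single i h : ι → ℝ) j * s y j = ∑ j, x j * s y j + h * s y i := by
        simp [add_mul, Finset.sum_add_distrib, Pi.single_apply]
      rw [this, neg_add, Real.exp_add]
      ring
    have hsub := fun x hx => (hint x hx).sub (hint _ (add_single_mem_posOrthant hx i hh.le))
    refine (ih (w := fun y => w y * (1 - Real.exp (-(h * s y i))))
      (fun y => mul_nonneg (hw y) (sub_nonneg.2 (Real.exp_le_one_iff.2 ?_)))
      (fun x hx => (hsub x hx).congr (.of_forall fun y => (key x y).symm))).congr fun x hx => ?_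
    · have := mul_nonneg hh.le (hs y i)
      linarith
    · simp only [key]
      exact integral_sub (hint x hx) (hint _ (add_single_mem_posOrthant hx i hh.le))

end AlternatingDifferences

theorem AlternatingDifferences.neg_fderivWithin [Fintype ι] {f : (ι → ℝ) → ℝ}
    (hd : DifferentiableOn ℝ f (posOrthant ι)) (hf : ∀ k, AlternatingDifferences k f)
    (i : ι) (k : ℕ) :
    AlternatingDifferences k
      (fun x => -fderivWithin ℝ f (posOrthant ι) x (Pi.single i 1)) := by
  refine of_tendsto (F := fun n x => ((n : ℝ) + 1) *
    (f x - f (x + Pi.single i ((n : ℝ) + 1)⁻¹))) (fun n => ?_) fun x hx => ?_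
  · exact (const (by positivity) k).mul ((hf (k + 1)).2 i _ (by positivity))
  · have hx' := isOpen_posOrthant.mem_nhds hx
    have h1 := ((hd x hx).differentiableAt hx').hasFDerivAt
    rw [fderivWithin_of_isOpen isOpen_posOrthant hx]
    have h2 : Tendsto (fun n : ℕ => ‖(n : ℝ) + 1‖) atTop atTop :=
      tendsto_norm_atTop_atTop.comp
        (tendsto_atTop_add_const_right _ _ tendsto_natCast_atTop_atTop)
    refine (h1.lim (Pi.single i 1) h2).neg.congr fun n => ?_
    rw [← Pi.single_smul, smul_eq_mul, smul_eq_mul, mul_one]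
    ring

theorem completelyMonotoneOnOrthant_of_alternatingDifferences [Fintype ι]
    {f : (ι → ℝ) → ℝ} (hd : ContDiffOn ℝ (⊤ : ℕ∞) f (posOrthant ι))
    (hf : ∀ k, AlternatingDifferences k f) : CompletelyMonotoneOnOrthant f := by
  refine ⟨hd, fun k => ?_⟩
  induction k generalizing f with
  | zero => intro idx x hx; simpa using (hf 0) x hx
  | succ k ih =>
    intro idx x hx
    have hu := (isOpen_posOrthant (ι := ι)).uniqueDiffOn (𝕜 := ℝ)
    have hd' : ContDiffOn ℝ (⊤ : ℕ∞) (fderivWithin ℝ f (posOrthant ι)) (posOrthant ι) :=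
      hd.fderivWithin hu (by simp)
    let L : ((ι → ℝ) →L[ℝ] ℝ) →L[ℝ] ℝ :=
      -ContinuousLinearMap.apply ℝ ℝ (Pi.single (idx (Fin.last k)) (1 : ℝ))
    have h1 := ih (f := fun x => L (fderivWithin ℝ f (posOrthant ι) x))
      (L.contDiff.comp_contDiffOn hd')
      (fun j => AlternatingDifferences.neg_fderivWithin (hd.differentiableOn (by simp)) hf _ j)
      (fun j => idx j.castSucc) x hx
    rw [show (fun x => L (fderivWithin ℝ f (posOrthant ι) x)) =
      L ∘ fderivWithin ℝ f (posOrthant ι) from rfl,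
      L.iteratedFDerivWithin_comp_left (hd' x hx) hu hx (by exact_mod_cast le_top)] at h1
    rw [iteratedFDerivWithin_succ_apply_right hu hx, pow_succ]
    simpa [L, Fin.init_def] using h1

end FiniteDifferences

section GaussianIntegral

open scoped Matrix

variable {m : Type*} [Fintype m] [DecidableEq m]

open scoped MatrixOrder in
theorem Matrix.PosDef.exists_schur_decomposition {A : Matrix (Unit ⊕ m) (Unit ⊕ m) ℝ}
    (hA : A.PosDef) :
    ∃ (d : ℝ) (L : Matrix (Unit ⊕ m) (Unit ⊕ m) ℝ), 0 < d ∧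
      (∀ y, (L *ᵥ y) (Sum.inl ()) = y (Sum.inl ())) ∧
      (∀ y, y ⬝ᵥ A *ᵥ y =
        d * (y (Sum.inl ())) ^ 2 + ∑ i, ((L *ᵥ y) (Sum.inr i)) ^ 2) ∧
      L.det ^ 2 = A.toBlocks₂₂.det ∧ A.det = d * A.toBlocks₂₂.det := by
  have hC : A.toBlocks₂₂.PosDef := hA.submatrix Sum.inr_injective
  obtain ⟨R, hR⟩ := CStarAlgebra.nonneg_iff_eq_star_mul_self.mp hC.posSemidef.nonneg
  rw [Matrix.star_eq_conjTranspose, Matrix.conjTranspose_eq_transpose_of_trivial] at hR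
  have hdetR : R.det ^ 2 = A.toBlocks₂₂.det := by
    rw [hR, Matrix.det_mul, Matrix.det_transpose, sq]
  have hRu : IsUnit Rᵀ.det := by
    rw [Matrix.det_transpose, isUnit_iff_ne_zero]
    intro h0
    have := hC.det_pos
    rw [← hdetR, h0] at this
    simp at this
  set B : Matrix m Unit ℝ := Rᵀ⁻¹ * A.toBlocks₂₁ with hB
  have hRB : Rᵀ * B = A.toBlocks₂₁ := by
    rw [hB, ← Matrix.mul_assoc, Matrix.mul_nonsing_inv _ hRu, Matrix.one_mul]
  have hsymm : A.toBlocks₁₂ = A.toBlocks₂₁ᵀ := by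
    ext i j
    exact (hA.isHermitian.apply (Sum.inl i) (Sum.inr j)).symm
  set S : Matrix Unit Unit ℝ := A.toBlocks₁₁ - Bᵀ * B with hS
  set L : Matrix (Unit ⊕ m) (Unit ⊕ m) ℝ := Matrix.fromBlocks 1 0 B R with hL
  have hfac : A = Lᵀ * Matrix.fromBlocks S 0 0 1 * L := by
    conv_lhs => rw [← Matrix.fromBlocks_toBlocks A]
    rw [hL, Matrix.fromBlocks_transpose, Matrix.fromBlocks_multiply, Matrix.fromBlocks_multiply]
    simp only [Matrix.transpose_one, Matrix.transpose_zero, Matrix.one_mul, Matrix.mul_one,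
      Matrix.mul_zero, Matrix.zero_mul, add_zero, zero_add]
    rw [hRB, ← hR, hsymm, ← hRB, Matrix.transpose_mul, Matrix.transpose_transpose, hS,
      sub_add_cancel]
  have hdetL : L.det = R.det := by simp [hL]
  have hdetA : A.det = S () () * A.toBlocks₂₂.det := by
    rw [hfac, Matrix.det_mul, Matrix.det_mul, Matrix.det_transpose, hdetL]
    rw [Matrix.det_fromBlocks_zero₂₁, Matrix.det_one, Matrix.det_unique S, ← hfac, ← hdetR]
    simp only [PUnit.default_eq_unit]
    ring
  have hinl : ∀ y, (L *ᵥ y) (Sum.inl ()) = y (Sum.inl ()) := by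
    intro y
    simp [hL, Matrix.mulVec, dotProduct]
  refine ⟨S () (), L, ?_, hinl, fun y => ?_, ?_, hdetA⟩
  · have h1 := hA.det_pos
    rw [hdetA] at h1
    exact pos_of_mul_pos_left h1 hC.det_pos.le
  · conv_lhs => rw [hfac]
    rw [← Matrix.mulVec_mulVec, ← Matrix.mulVec_mulVec, Matrix.dotProduct_mulVec,
      Matrix.vecMul_transpose, ← hinl y]
    generalize L *ᵥ y = z
    simp [Matrix.mulVec, dotProduct, Matrix.one_apply]
    ring_nf
  · rw [hdetL, hdetR]

/-- The weight `t ↦ t ^ s` on the half-line `t > 0` of the first coordinate. -/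
noncomputable def halfLineWeight (s : ℝ) (y : Unit ⊕ m → ℝ) : ℝ :=
  (Set.Ioi (0 : ℝ)).indicator (fun t => t ^ s) (y (Sum.inl ()))

omit [Fintype m] [DecidableEq m] in
theorem halfLineWeight_nonneg (s : ℝ) (y : Unit ⊕ m → ℝ) : 0 ≤ halfLineWeight s y :=
  Set.indicator_nonneg (fun _ ht => Real.rpow_nonneg (le_of_lt ht) _) _

theorem integrable_and_integral_halfLineWeight_mul_exp {A : Matrix (Unit ⊕ m) (Unit ⊕ m) ℝ}
    (hA : A.PosDef) {β : ℝ} (hβ : 0 < β) :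
    Integrable (fun y => halfLineWeight (2 * β - 1) y * Real.exp (-(y ⬝ᵥ A *ᵥ y))) ∧
    ∫ y, halfLineWeight (2 * β - 1) y * Real.exp (-(y ⬝ᵥ A *ᵥ y)) =
      (1 / 2 * Real.Gamma β * √Real.pi ^ Fintype.card m) *
        (A.det ^ (-β) * A.toBlocks₂₂.det ^ (β - 1 / 2)) := by
  have hC : A.toBlocks₂₂.PosDef := hA.submatrix Sum.inr_injective
  obtain ⟨d, L, hd, hinl, hquad, hdetL, hdetA⟩ := hA.exists_schur_decomposition
  let φ : Unit ⊕ m → ℝ → ℝ := Sum.elim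
    (fun _ => (Set.Ioi (0 : ℝ)).indicator fun t => t ^ (2 * β - 1) * Real.exp (-d * t ^ 2))
    (fun _ t => Real.exp (-1 * t ^ 2))
  let g : (Unit ⊕ m → ℝ) → ℝ := fun z => ∏ i, φ i (z i)
  have hfg : (fun y => halfLineWeight (2 * β - 1) y * Real.exp (-(y ⬝ᵥ A *ᵥ y))) =
      fun y => g (Matrix.toLin' L y) := by
    ext y
    simp only [g, φ, Fintype.prod_sum_type, Finset.univ_unique, PUnit.default_eq_unit,
      Finset.prod_singleton, Sum.elim_inl, Sum.elim_inr, Matrix.toLin'_apply, hinl,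
      ← Real.exp_sum, hquad, halfLineWeight, ← Finset.mul_sum]
    by_cases h : 0 < y (Sum.inl ())
    · rw [Set.indicator_of_mem (by exact h), Set.indicator_of_mem (by exact h), mul_assoc,
        ← Real.exp_add]
      ring_nf
    · rw [Set.indicator_of_notMem (by exact h), Set.indicator_of_notMem (by exact h)]
      simp
  have hint : ∀ i, Integrable (φ i) := by
    rintro (_ | _)
    · exact (integrable_indicator_iff measurableSet_Ioi).2
        (integrableOn_rpow_mul_exp_neg_mul_sq hd (by linarith))
    · exact integrable_exp_neg_mul_sq one_pos
  have hg : Integrable g := Integrable.fintype_prod hint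
  have hL0 : L.det ≠ 0 := by
    intro h0
    have := hC.det_pos
    rw [← hdetL, h0] at this
    simp at this
  have hmap := Real.map_matrix_volume_pi_eq_smul_volume_pi hL0
  have hmeas : AEMeasurable (Matrix.toLin' L) (volume : Measure (Unit ⊕ m → ℝ)) :=
    (LinearMap.continuous_of_finiteDimensional _).measurable.aemeasurable
  have hg' : Integrable g (Measure.map (Matrix.toLin' L) volume) := by
    rw [hmap]
    exact hg.smul_measure ENNReal.ofReal_ne_top
  rw [hfg]
  refine ⟨(integrable_map_measure hg'.1 hmeas).1 hg', ?_⟩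
  rw [← integral_map hmeas hg'.1, hmap, integral_smul_measure,
    integral_fintype_prod_volume_eq_prod, Fintype.prod_sum_type]
  simp only [φ, Finset.univ_unique, Finset.card_singleton, pow_one, Sum.elim_inl,
    Sum.elim_inr, integral_gaussian, Finset.prod_const, Finset.card_univ, div_one,
    integral_indicator measurableSet_Ioi, smul_eq_mul]
  have h1 := integral_rpow_mul_exp_neg_mul_rpow (p := 2) (q := 2 * β - 1) two_pos
    (by linarith) hd
  simp only [Real.rpow_two] at h1
  rw [h1, ENNReal.toReal_ofReal (abs_nonneg _), abs_inv, ← Real.sqrt_sq_eq_abs, hdetL, hdetA,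
    Real.mul_rpow hd.le hC.det_pos.le, Real.sqrt_eq_rpow, ← Real.rpow_neg hC.det_pos.le,
    show -(2 * β - 1 + 1) / 2 = -β by ring, show (2 * β - 1 + 1) / 2 = β by ring,
    show β - 1 / 2 = β + -(1 / 2) by ring, Real.rpow_add hC.det_pos,
    Real.rpow_neg hC.det_pos.le β]
  have := (Real.rpow_pos_of_pos hC.det_pos β).ne'
  field_simp

end GaussianIntegral

section WeightedGram

open scoped Matrix

variable {E m : Type*} [Fintype E] [Fintype m]

/-- The matrix `∑ e, x e • a e (a e)ᵀ`. -/
def weightedGram {R : Type*} [CommRing R] (a : E → m → R) (x : E → R) : Matrix m m R :=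
  Matrix.of fun i j => ∑ e, x e * a e i * a e j

theorem dotProduct_weightedGram_mulVec (a : E → m → ℝ) (x : E → ℝ) (y : m → ℝ) :
    y ⬝ᵥ weightedGram a x *ᵥ y = ∑ e, x e * (a e ⬝ᵥ y) ^ 2 := by
  simp only [weightedGram, dotProduct, Matrix.mulVec, Matrix.of_apply, Finset.sum_mul,
    Finset.mul_sum, sq]
  rw [Finset.sum_congr rfl fun _ _ => Finset.sum_comm, Finset.sum_comm]
  refine Finset.sum_congr rfl fun e _ => Finset.sum_congr rfl fun i _ =>
    Finset.sum_congr rfl fun j _ => by ring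

theorem posDef_weightedGram {a : E → m → ℝ} (ha : ∀ y, (∀ e, a e ⬝ᵥ y = 0) → y = 0)
    {x : E → ℝ} (hx : x ∈ posOrthant E) : (weightedGram a x).PosDef := by
  refine Matrix.PosDef.of_dotProduct_mulVec_pos ?_ fun y hy => ?_
  · ext i j
    simp only [weightedGram, Matrix.conjTranspose_apply, Matrix.of_apply, star_trivial]
    exact Finset.sum_congr rfl fun e _ => by ring
  · rw [star_trivial, dotProduct_weightedGram_mulVec]
    have hnn : ∀ e ∈ Finset.univ, 0 ≤ x e * (a e ⬝ᵥ y) ^ 2 := fun e _ =>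
      mul_nonneg (hx e).le (sq_nonneg _)
    refine (Finset.sum_nonneg hnn).lt_of_ne' fun h0 => hy (ha y fun e => ?_)
    have := (Finset.sum_eq_zero_iff_of_nonneg hnn).1 h0 e (Finset.mem_univ e)
    simpa [(hx e).ne'] using this

variable [DecidableEq E] [DecidableEq m]

theorem AlternatingDifferences.det_weightedGram_rpow_sum {a : E → Unit ⊕ m → ℝ}
    (ha : ∀ y, (∀ e, a e ⬝ᵥ y = 0) → y = 0) {β : ℝ} (hβ : 0 < β) {k : ℕ}
    (h : AlternatingDifferences k fun x : E → ℝ =>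
      (weightedGram (fun e i => a e (Sum.inr i)) x).det ^ (-(β - 1 / 2))) :
    AlternatingDifferences k fun x : E → ℝ => (weightedGram a x).det ^ (-β) := by
  have hblock : ∀ x, (weightedGram a x).toBlocks₂₂ =
      weightedGram (fun e i => a e (Sum.inr i)) x := fun x => rfl
  have hquad : ∀ (x : E → ℝ) (y : Unit ⊕ m → ℝ),
      ∑ e, x e * (a e ⬝ᵥ y) ^ 2 = y ⬝ᵥ weightedGram a x *ᵥ y := fun x y =>
    (dotProduct_weightedGram_mulVec a x y).symm
  have hgauss := fun x (hx : x ∈ posOrthant E) =>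
    integrable_and_integral_halfLineWeight_mul_exp (posDef_weightedGram ha hx) hβ
  have hexp : AlternatingDifferences k fun x : E → ℝ => ∫ y : Unit ⊕ m → ℝ,
      halfLineWeight (2 * β - 1) y * Real.exp (-∑ e, x e * (a e ⬝ᵥ y) ^ 2) :=
    integral_exp (s := fun y e => (a e ⬝ᵥ y) ^ 2) (fun y e => sq_nonneg _)
      (halfLineWeight_nonneg _) (fun x hx => by simpa only [hquad] using (hgauss x hx).1) k
  have hK : 0 < 1 / 2 * Real.Gamma β * √Real.pi ^ Fintype.card m := by
    have := Real.Gamma_pos_of_pos hβ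
    have := Real.pi_pos
    positivity
  refine (((const (inv_pos.2 hK).le k).mul hexp).mul h).congr fun x hx => ?_
  have hC : 0 < (weightedGram a x).toBlocks₂₂.det :=
    ((posDef_weightedGram ha hx).submatrix Sum.inr_injective).det_pos
  simp only [hquad]
  rw [(hgauss x hx).2, inv_mul_cancel_left₀ hK.ne', mul_assoc, ← hblock,
    ← Real.rpow_add hC, add_neg_cancel, Real.rpow_zero, mul_one]

theorem AlternatingDifferences.det_weightedGram_rpow {n : ℕ} {a : E → Fin n → ℝ}
    (ha : ∀ y, (∀ e, a e ⬝ᵥ y = 0) → y = 0) {β : ℝ}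
    (hβ : (∃ k : ℕ, β = (k : ℝ) / 2) ∨ ((n : ℝ) - 1) / 2 ≤ β) (k : ℕ) :
    AlternatingDifferences k fun x : E → ℝ => (weightedGram a x).det ^ (-β) := by
  induction n generalizing β with
  | zero => simpa using const (ι := E) zero_le_one k
  | succ n ih =>
    have hβ0 : 0 ≤ β := by
      rcases hβ with ⟨j, rfl⟩ | hβ
      · positivity
      · push_cast at hβ
        have : (0 : ℝ) ≤ n := n.cast_nonneg
        linarith
    rcases hβ0.eq_or_lt with rfl | hpos
    · simpa using const (ι := E) zero_le_one k
    · have hβ' : (∃ k : ℕ, β - 1 / 2 = (k : ℝ) / 2) ∨ ((n : ℝ) - 1) / 2 ≤ β - 1 / 2 := by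
        rcases hβ with ⟨j, rfl⟩ | hβ
        · left
          cases j with
          | zero => simp at hpos
          | succ j => exact ⟨j, by push_cast; ring⟩
        · right
          push_cast at hβ
          linarith
      let φ : Unit ⊕ Fin n ≃ Fin (n + 1) := Fintype.equivOfCardEq (by simp [add_comm])
      have hspan : ∀ y, (∀ e, (fun i => a e (φ i)) ⬝ᵥ y = 0) → y = 0 := by
        intro y hy
        have h0 := ha (y ∘ φ.symm) fun e => by
          rw [← hy e, dotProduct, dotProduct, ← φ.sum_comp]
          simp
        ext i
        simpa using congrFun h0 (φ i)
      have hspan' : ∀ y, (∀ e, (fun i => a e (φ (Sum.inr i))) ⬝ᵥ y = 0) → y = 0 := by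
        intro y hy
        have h0 := hspan (Sum.elim 0 y) fun e => by
          simpa [dotProduct] using hy e
        ext i
        simpa using congrFun h0 (Sum.inr i)
      refine (det_weightedGram_rpow_sum hspan hpos (ih hspan' hβ')).congr fun x _ => ?_
      have : weightedGram (fun e i => a e (φ i)) x = (weightedGram a x).submatrix φ φ := rfl
      rw [this, Matrix.det_submatrix_equiv_self]

end WeightedGram

section CauchyBinet

variable {E m R : Type*} [Fintype E] [Fintype m] [DecidableEq E] [DecidableEq m] [CommRing R]

open Classical in
/-- The coefficient of `∏ e ∈ t, x e` in the determinant of `∑ e, x e • a e (a e)ᵀ`. -/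
noncomputable def gramDetCoeff (a : E → m → R) (t : Finset E) : R :=
  ∑ f : m → E with Function.Injective f ∧ Finset.univ.image f = t,
    (∏ i, a (f i) i) * (Matrix.of fun i => a (f i)).det

theorem det_weightedGram (a : E → m → R) (x : E → R) :
    (weightedGram a x).det = ∑ t : Finset E, gramDetCoeff a t * ∏ e ∈ t, x e := by
  classical
  have hrow : weightedGram a x = fun i => ∑ e, (x e * a e i) • a e := by
    ext i j
    simp [weightedGram, Finset.sum_apply]
  have h1 : (weightedGram a x).det = ∑ f : m → E,
      (∏ i, x (f i)) * ((∏ i, a (f i) i) * (Matrix.of fun i => a (f i)).det) := by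
    rw [hrow]
    refine ((Matrix.detRowAlternating (R := R)).toMultilinearMap.map_sum
      fun (i : m) e => (x e * a e i) • a e).trans ?_
    refine Finset.sum_congr rfl fun f _ => ?_
    refine ((Matrix.detRowAlternating (R := R)).toMultilinearMap.map_smul_univ
      (fun i => x (f i) * a (f i) i) fun i => a (f i)).trans ?_
    rw [Finset.prod_mul_distrib, smul_eq_mul, mul_assoc]
    rfl
  have h2 : ∀ f : m → E, ¬ Function.Injective f → (Matrix.of fun i => a (f i)).det = 0 := by
    intro f hf
    obtain ⟨i, j, hij, hne⟩ : ∃ i j, f i = f j ∧ i ≠ j := by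
      simpa [Function.Injective] using hf
    exact Matrix.det_zero_of_row_eq hne (by ext; simp [hij])
  rw [h1, ← Finset.sum_fiberwise Finset.univ (fun f : m → E => Finset.univ.image f)]
  refine Finset.sum_congr rfl fun t _ => ?_
  rw [gramDetCoeff, Finset.sum_mul]
  refine (Finset.sum_subset (Finset.monotone_filter_right _ fun f _ hf => hf.2)
    fun f hf hf' => ?_).symm.trans (Finset.sum_congr rfl fun f hf => ?_)
  · simp only [Finset.mem_filter, Finset.mem_univ, true_and] at hf hf'
    rw [h2 f fun hinj => hf' ⟨hinj, hf⟩, mul_zero, mul_zero]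
  · simp only [Finset.mem_filter, Finset.mem_univ, true_and] at hf
    rw [← hf.2, Finset.prod_image fun i _ j _ hij => hf.1 hij, mul_comm]

theorem gramDetCoeff_eq_zero_of_card_ne (a : E → m → R) {t : Finset E}
    (ht : t.card ≠ Fintype.card m) : gramDetCoeff a t = 0 := by
  classical
  refine Finset.sum_eq_zero fun f hf => absurd ?_ ht
  rw [Finset.mem_filter] at hf
  rw [← hf.2.2, Finset.card_image_of_injective _ hf.2.1, Finset.card_univ]

theorem gramDetCoeff_image (a : E → m → R) {f : m → E} (hf : Function.Injective f) :
    gramDetCoeff a (Finset.univ.image f) = (Matrix.of fun i => a (f i)).det ^ 2 := by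
  classical
  have h1 : gramDetCoeff a (Finset.univ.image f) = ∑ σ : Equiv.Perm m,
      (∏ i, a (f (σ i)) i) * (Matrix.of fun i => a (f (σ i))).det := by
    symm
    refine Finset.sum_bij (fun σ _ => f ∘ σ) ?_ ?_ ?_ ?_
    · intro σ _
      simp only [Finset.mem_filter, Finset.mem_univ, true_and]
      refine ⟨hf.comp σ.injective, ?_⟩
      rw [← Finset.image_image, Finset.image_univ_equiv]
    · intro σ _ τ _ h
      ext i
      exact hf (congrFun h i)
    · intro g hg
      simp only [Finset.mem_filter, Finset.mem_univ, true_and] at hg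
      have : ∀ i, ∃ j, f j = g i := fun i => by
        have : g i ∈ Finset.univ.image f := hg.2 ▸ Finset.mem_image_of_mem g (Finset.mem_univ i)
        simpa using this
      choose σ hσ using this
      have hinj : Function.Injective σ := fun i j hij => hg.1 (by rw [← hσ, ← hσ, hij])
      exact ⟨Equiv.ofBijective σ (Finite.injective_iff_bijective.1 hinj), Finset.mem_univ _,
        funext hσ⟩
    · intro σ _
      rfl
  rw [h1, sq]
  nth_rewrite 1 [Matrix.det_apply' (Matrix.of fun i => a (f i))]
  rw [Finset.sum_mul]
  refine Finset.sum_congr rfl fun σ _ => ?_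
  have := Matrix.det_permute σ (Matrix.of fun i => a (f i))
  rw [show (Matrix.of fun i => a (f (σ i))) = (Matrix.of fun i => a (f i)).submatrix σ id from rfl,
    this]
  simp only [Matrix.of_apply]
  ring

end CauchyBinet

section MatrixTree

open scoped Matrix

theorem gramDetCoeff_map {E m R S : Type*} [Fintype E] [Fintype m] [DecidableEq E]
    [DecidableEq m] [CommRing R] [CommRing S] (φ : R →+* S) (a : E → m → R) (t : Finset E) :
    gramDetCoeff (fun e i => φ (a e i)) t = φ (gramDetCoeff a t) := by
  simp only [gramDetCoeff, map_sum, map_mul, map_prod, RingHom.map_det]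
  rfl

theorem SimpleGraph.Reachable.apply_eq {V α : Type*} {G : SimpleGraph V} {z : V → α}
    (hz : ∀ u v, G.Adj u v → z u = z v) {u v : V} (h : G.Reachable u v) : z u = z v := by
  obtain ⟨p⟩ := h
  induction p with
  | nil => rfl
  | cons hadj _ ih => rw [hz _ _ hadj, ih]

variable {V : Type*} {G : SimpleGraph V}

/-- The graph on the vertices of `G` with edge set `t`. -/
abbrev edgeSubgraph (t : Finset G.edgeSet) : SimpleGraph V :=
  SimpleGraph.fromEdgeSet (Subtype.val '' (t : Set G.edgeSet))

theorem edgeSubgraph_adj {t : Finset G.edgeSet} {u v : V} (h : (edgeSubgraph t).Adj u v) :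
    ∃ e ∈ t, (e.1.out.1 = u ∧ e.1.out.2 = v) ∨ (e.1.out.1 = v ∧ e.1.out.2 = u) := by
  obtain ⟨⟨e, het, he⟩, -⟩ := (SimpleGraph.fromEdgeSet_adj _).1 h
  refine ⟨e, het, ?_⟩
  have h1 : s(e.1.out.1, e.1.out.2) = s(u, v) := he ▸ Quot.out_eq e.1
  exact Sym2.eq_iff.1 h1

theorem edgeSubgraph_adj_out {t : Finset G.edgeSet} {e : G.edgeSet} (he : e ∈ t) :
    (edgeSubgraph t).Adj e.1.out.1 e.1.out.2 := by
  have h1 : s(e.1.out.1, e.1.out.2) = e.1 := Quot.out_eq e.1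
  refine (SimpleGraph.fromEdgeSet_adj _).2 ⟨⟨e, he, h1.symm⟩, ?_⟩
  exact SimpleGraph.Adj.ne (G := G) (by rw [← SimpleGraph.mem_edgeSet, h1]; exact e.2)

theorem edgeSubgraph_univ [Fintype G.edgeSet] :
    edgeSubgraph (Finset.univ : Finset G.edgeSet) = G := by
  simp [edgeSubgraph]

theorem card_edgeSet_edgeSubgraph (t : Finset G.edgeSet) :
    Nat.card (edgeSubgraph t).edgeSet = t.card := by
  have : (edgeSubgraph t).edgeSet = Subtype.val '' (t : Set G.edgeSet) := by
    rw [SimpleGraph.edgeSet_fromEdgeSet, sdiff_eq_left, Set.disjoint_left]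
    rintro _ ⟨e, -, rfl⟩ hd
    exact G.not_isDiag_of_mem_edgeSet e.2 hd
  rw [this, Nat.card_image_of_injective Subtype.val_injective]
  simp

variable [DecidableEq V]

/-- The row of the edge `e` in an oriented incidence matrix of `G` with the column of the
vertex `r` removed. -/
noncomputable def reducedIncidence (r : V) (e : G.edgeSet) (v : {v // v ≠ r}) : ℤ :=
  (if v.1 = e.1.out.1 then 1 else 0) - (if v.1 = e.1.out.2 then 1 else 0)

variable [Fintype V]

theorem reducedIncidence_dotProduct {R : Type*} [CommRing R] {r : V} (e : G.edgeSet)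
    {z : V → R} (hz : z r = 0) :
    (fun v => (reducedIncidence r e v : R)) ⬝ᵥ (fun v => z v) = z e.1.out.1 - z e.1.out.2 := by
  have h : ∀ w : V, ∑ v : {v // v ≠ r}, (if v.1 = w then z v else 0) = z w := by
    intro w
    by_cases hw : w = r
    · subst hw
      rw [hz]
      exact Finset.sum_eq_zero fun v _ => if_neg v.2
    · rw [Finset.sum_eq_single ⟨w, hw⟩ (fun v _ hv => if_neg fun h => hv (Subtype.ext h))
        (by simp), if_pos rfl]
  simp [reducedIncidence, dotProduct, sub_mul, Finset.sum_sub_distrib, h]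

theorem eq_zero_of_reducedIncidence_dotProduct [Fintype G.edgeSet] (hG : G.Connected) {r : V}
    {y : {v // v ≠ r} → ℝ}
    (hy : ∀ e : G.edgeSet, (fun v => (reducedIncidence r e v : ℝ)) ⬝ᵥ y = 0) : y = 0 := by
  let z : V → ℝ := fun v => if h : v ≠ r then y ⟨v, h⟩ else 0
  have hzr : z r = 0 := by simp [z]
  have hzy : (fun v : {v // v ≠ r} => z v) = y := by
    ext v
    simp [z, v.2]
  have hz : ∀ u v, (edgeSubgraph (Finset.univ : Finset G.edgeSet)).Adj u v → z u = z v := by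
    intro u v huv
    obtain ⟨e, -, h⟩ := edgeSubgraph_adj huv
    have h0 := reducedIncidence_dotProduct e hzr
    rw [hzy, hy e] at h0
    rcases h with ⟨h1, h2⟩ | ⟨h1, h2⟩ <;> rw [h1, h2] at h0 <;> linarith
  rw [edgeSubgraph_univ] at hz
  rw [← hzy]
  ext v
  rw [← (hG.preconnected r v).apply_eq hz, hzr]
  rfl

theorem sq_det_reducedIncidence_of_connected {r : V} {t : Finset G.edgeSet}
    {f : {v // v ≠ r} → G.edgeSet} (hf : Finset.univ.image f = t)
    (ht : (edgeSubgraph t).Connected) :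
    (Matrix.of fun i => reducedIncidence r (f i)).det ^ 2 = 1 := by
  set M := Matrix.of fun i => reducedIncidence r (f i)
  have hspan : ∀ v : V, ∃ c : {v // v ≠ r} → ℤ,
      c ᵥ* M = fun j => if j.1 = v then 1 else 0 := by
    have hz : ∀ u v, (edgeSubgraph t).Adj u v →
        (∃ c : {v // v ≠ r} → ℤ, c ᵥ* M = fun j => if j.1 = u then 1 else 0) →
        ∃ c : {v // v ≠ r} → ℤ, c ᵥ* M = fun j => if j.1 = v then 1 else 0 := by
      rintro u v huv ⟨c, hc⟩
      obtain ⟨e, het, h⟩ := edgeSubgraph_adj huv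
      rw [← hf] at het
      obtain ⟨i, -, rfl⟩ := Finset.mem_image.1 het
      rcases h with ⟨h1, h2⟩ | ⟨h1, h2⟩
      · refine ⟨c - Pi.single i 1, ?_⟩
        ext j
        simp [Matrix.sub_vecMul, hc, M, reducedIncidence, h1, h2]
      · refine ⟨c + Pi.single i 1, ?_⟩
        ext j
        simp [Matrix.add_vecMul, hc, M, reducedIncidence, h1, h2]
    intro v
    refine ((ht.preconnected r v).apply_eq (z := fun u => ∃ c : {v // v ≠ r} → ℤ,
      c ᵥ* M = fun j => if j.1 = u then 1 else 0)
      fun u v huv => propext ⟨hz u v huv, hz v u huv.symm⟩).mp ⟨0, ?_⟩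
    ext j
    simp [j.2]
  choose c hc using hspan
  have hNM : (Matrix.of fun i : {v // v ≠ r} => c i) * M = 1 := by
    ext i j
    have := congrFun (hc i) j
    rw [Matrix.mul_apply_eq_vecMul, Matrix.one_apply]
    change (c i ᵥ* M) j = _
    simpa [Subtype.ext_iff, eq_comm] using this
  have hu : IsUnit M.det := by
    refine IsUnit.of_mul_eq_one_right (Matrix.of fun i : {v // v ≠ r} => c i).det ?_
    rw [← Matrix.det_mul, hNM, Matrix.det_one]
  rcases Int.isUnit_iff.1 hu with h | h <;> simp [h]

theorem det_reducedIncidence_of_not_connected {r : V} {t : Finset G.edgeSet}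
    {f : {v // v ≠ r} → G.edgeSet} (hf : Finset.univ.image f = t)
    (ht : ¬ (edgeSubgraph t).Connected) :
    (Matrix.of fun i => reducedIncidence r (f i)).det = 0 := by
  classical
  obtain ⟨v, hv⟩ : ∃ v, ¬ (edgeSubgraph t).Reachable r v := by
    by_contra! h
    exact ht ((SimpleGraph.connected_iff _).2 ⟨fun u v => (h u).symm.trans (h v), ⟨r⟩⟩)
  let z : V → ℤ := fun v => if (edgeSubgraph t).Reachable r v then 0 else 1
  have hzr : z r = 0 := if_pos (SimpleGraph.Reachable.refl r)
  refine Matrix.exists_mulVec_eq_zero_iff.1 ⟨fun j => z j, fun h0 => ?_, ?_⟩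
  · have hvr : v ≠ r := by
      rintro rfl
      exact hv (SimpleGraph.Reachable.refl v)
    simpa [z, hv] using congrFun h0 ⟨v, hvr⟩
  · ext i
    have h1 := reducedIncidence_dotProduct (f i) hzr
    have hadj : (edgeSubgraph t).Adj (f i).1.out.1 (f i).1.out.2 :=
      edgeSubgraph_adj_out (hf ▸ Finset.mem_image_of_mem f (Finset.mem_univ i))
    have h2 : z (f i).1.out.1 = z (f i).1.out.2 := by
      have : (edgeSubgraph t).Reachable r (f i).1.out.1 ↔
          (edgeSubgraph t).Reachable r (f i).1.out.2 :=
        ⟨fun h => h.trans hadj.reachable, fun h => h.trans hadj.symm.reachable⟩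
      simp only [z, this]
    rw [h2, sub_self] at h1
    exact h1

open scoped Classical in
theorem gramDetCoeff_reducedIncidence [Fintype G.edgeSet] (r : V) (t : Finset G.edgeSet) :
    gramDetCoeff (reducedIncidence r) t = if IsSpanningTree G (t : Set G.edgeSet) then 1 else 0 := by
  have hcardV : Fintype.card {v // v ≠ r} + 1 = Nat.card V := by
    have h1 := Fintype.card_pos_iff.2 ⟨r⟩
    have h2 : Fintype.card {v // v ≠ r} = Fintype.card V - 1 := by simp
    rw [h2, Nat.card_eq_fintype_card, Nat.sub_add_cancel h1]
  have hst : IsSpanningTree G (t : Set G.edgeSet) ↔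
      (edgeSubgraph t).Connected ∧ t.card = Fintype.card {v // v ≠ r} := by
    rw [← card_edgeSet_edgeSubgraph, ← Nat.add_right_cancel_iff (n := 1), hcardV,
      ← SimpleGraph.isTree_iff_connected_and_card, SimpleGraph.isTree_iff]
    rfl
  by_cases hcard : t.card = Fintype.card {v // v ≠ r}
  · obtain ⟨g⟩ : Nonempty ({v // v ≠ r} ≃ t) := Fintype.card_eq.1 (by simpa using hcard.symm)
    have himg : Finset.univ.image (fun i => (g i : G.edgeSet)) = t := by
      ext e
      simp only [Finset.mem_image, Finset.mem_univ, true_and]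
      exact ⟨by rintro ⟨i, rfl⟩; exact (g i).2, fun he => ⟨g.symm ⟨e, he⟩, by simp⟩⟩
    have h1 := gramDetCoeff_image (reducedIncidence r)
      (f := fun i => (g i : G.edgeSet)) (Subtype.val_injective.comp g.injective)
    rw [himg] at h1
    rw [h1]
    split_ifs with h
    · exact sq_det_reducedIncidence_of_connected himg (hst.1 h).1
    · rw [det_reducedIncidence_of_not_connected himg fun hc => h (hst.2 ⟨hc, hcard⟩)]
      simp
  · rw [gramDetCoeff_eq_zero_of_card_ne _ hcard, if_neg fun h => hcard (hst.1 h).2]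

theorem det_weightedGram_reducedIncidence [Fintype G.edgeSet] (r : V) (x : G.edgeSet → ℝ) :
    (weightedGram (fun e v => (reducedIncidence r e v : ℝ)) x).det = spanningTreePoly G x := by
  classical
  rw [det_weightedGram, spanningTreePoly, Finset.sum_filter]
  refine Finset.sum_congr rfl fun t _ => ?_
  have := gramDetCoeff_map (Int.castRingHom ℝ) (reducedIncidence r) t
  simp only [eq_intCast] at this
  rw [this, gramDetCoeff_reducedIncidence]
  split_ifs <;> simp

end MatrixTree

theorem contDiff_spanningTreePoly {V : Type*} (G : SimpleGraph V) [Fintype G.edgeSet] :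
    ContDiff ℝ (⊤ : ℕ∞) (spanningTreePoly G) := by
  unfold spanningTreePoly
  fun_prop

/-- Let `G` be a connected finite simple graph on `p` vertices with
edge set `E`.  Then its spanning-tree polynomial `T_G` is strictly positive on `(0,∞)^E`,
and `T_G^{-β}` is completely monotone on `(0,∞)^E` for every `β ∈ {0, 1/2, 1, 3/2, …}`
and every real `β ≥ (p−2)/2`. -/
theorem inverse_power_spanning_tree_poly_completely_monotone
    {V : Type*} [Fintype V] [DecidableEq V] (G : SimpleGraph V) [Fintype G.edgeSet]
    (hconn : G.Connected)
    (β : ℝ)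
    (hβ : (∃ k : ℕ, β = (k : ℝ) / 2) ∨ ((Fintype.card V : ℝ) - 2) / 2 ≤ β) :
    (∀ x ∈ posOrthant G.edgeSet, 0 < spanningTreePoly G x) ∧
      CompletelyMonotoneOnOrthant
        (fun x : G.edgeSet → ℝ => spanningTreePoly G x ^ (-β)) := by
  obtain ⟨r⟩ := hconn.nonempty
  have hspan := fun y => eq_zero_of_reducedIncidence_dotProduct hconn (r := r) (y := y)
  have hpos : ∀ x ∈ posOrthant G.edgeSet, 0 < spanningTreePoly G x := fun x hx => by
    rw [← det_weightedGram_reducedIncidence r]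
    exact (posDef_weightedGram hspan hx).det_pos
  refine ⟨hpos, completelyMonotoneOnOrthant_of_alternatingDifferences ?_ fun k => ?_⟩
  · exact (contDiff_spanningTreePoly G).contDiffOn.rpow_const_of_ne fun x hx => (hpos x hx).ne'
  · let φ : Fin (Fintype.card V - 1) ≃ {v // v ≠ r} := Fintype.equivOfCardEq (by simp)
    have hcard : ((Fintype.card V - 1 : ℕ) : ℝ) - 1 = (Fintype.card V : ℝ) - 2 := by
      rw [Nat.cast_sub (Fintype.card_pos_iff.2 ⟨r⟩)]
      push_cast
      ring
    rw [← hcard] at hβ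
    refine (AlternatingDifferences.det_weightedGram_rpow
      (a := fun e i => (reducedIncidence r e (φ i) : ℝ)) (fun y hy => ?_) hβ k).congr fun x _ => ?_
    · have h0 := hspan (y ∘ φ.symm) fun e => by
        rw [← hy e, dotProduct, dotProduct, ← φ.sum_comp]
        simp
      ext i
      simpa using congrFun h0 (φ i)
    · rw [← det_weightedGram_reducedIncidence r, ← Matrix.det_submatrix_equiv_self φ]
      rfl
end
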